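/- Let Ω ⊆ ℍ be a (1,3)-symmetric (1,3)-slice domain, set D := {(z,β) ∈ ℂ×ℝ : z+βJ ∈ Ω for every J ∈ S¹}, and let f : Ω → ℍ be a (1,3)-regular function. Then there exist unique functions F_∅, F₁ : D → ℍ with F_∅(z,−β) = F_∅(z,β) and F₁(z,−β) = −F₁(z,β) for all (z,β) ∈ D, such that f(z+βJ) = F_∅(z,β) + J·F₁(z,β) for all (z,β) ∈ D and all J ∈ S¹. Moreover: F_∅ and F₁ are real analytic on D (which is open in ℂ×ℝ) and f is real analytic on Ω; writing z = x₀+ix₁, the system (∂_{x₀}+i∂_{x₁})F_∅ − ∂_βF₁ = 0 and ∂_βF_∅ + (∂_{x₀}−i∂_{x₁})F₁ = 0 holds on D, and consequently F_∅ and F₁ are harmonic in the three real variables (x₀,x₁,β); finally, f satisfies f(Ω ∩ ℝ³_J) ⊆ ℝ³_J for every J ∈ S¹ if and only if F_∅ takes values in ℂ and F₁ takes values in ℝ+jℝ+kℝ. -/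

import Mathlib

open Quaternion

noncomputable section

/-- The real quaternions. -/
abbrev H : Type := Quaternion ℝ

/-- The imaginary unit `i`. -/
def qi : H := ⟨0, 1, 0, 0⟩
/-- The imaginary unit `j`. -/
def qj : H := ⟨0, 0, 1, 0⟩
/-- The imaginary unit `k`. -/
def qk : H := ⟨0, 0, 0, 1⟩

/-- `S¹`: the circle of unit quaternions in the plane `jℝ + kℝ`. -/
def S1 : Set H := {J : H | J.re = 0 ∧ J.imI = 0 ∧ J.imJ ^ 2 + J.imK ^ 2 = 1}

/-- The subset `ℂ = ℝ + iℝ` of `ℍ` (the mirror). -/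
def Cset : Set H := {x : H | x.imJ = 0 ∧ x.imK = 0}

/-- Coordinates `(x₀,x₁,β) ↦ x₀ + i x₁ + β J` for the hyperplane `ℝ³_J`. -/
def psi (J : H) (u : ℝ × ℝ × ℝ) : H := (u.1 : H) + u.2.1 • qi + u.2.2 • J

/-- The hyperplane `ℝ³_J = Span_ℝ(1, i, J)` of `ℍ`, as the range of `psi J`. -/
def hplane (J : H) : Set H := Set.range (psi J)

/-- `f` is `J`-monogenic on the `J`-hplane of `Ω`: in the coordinates `(x₀,x₁,β)`,
the restriction of `f` to `Ω ∩ ℝ³_J` is real-differentiable and satisfies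
`∂_{x₀}f + i·∂_{x₁}f + J·∂_βf = 0`. -/
def JMonogenicOn (J : H) (f : H → H) (Ω : Set H) : Prop :=
  ∀ u : ℝ × ℝ × ℝ, psi J u ∈ Ω →
    DifferentiableAt ℝ (fun v => f (psi J v)) u ∧
    fderiv ℝ (fun v => f (psi J v)) u (1, 0, 0)
      + qi * fderiv ℝ (fun v => f (psi J v)) u (0, 1, 0)
      + J * fderiv ℝ (fun v => f (psi J v)) u (0, 0, 1) = 0

/-- `f` is `(1,3)`-regular on `Ω`: for every `J ∈ S¹`, the restriction of `f`
to `Ω ∩ ℝ³_J` is `J`-monogenic. -/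
def Regular13 (f : H → H) (Ω : Set H) : Prop :=
  ∀ J ∈ S1, JMonogenicOn J f Ω

/-- `Ω` is a `(1,3)`-slice domain: a domain intersecting the mirror `ℂ`, whose
`J`-slices `Ω ∩ ℝ³_J` are all connected. -/
def IsSliceDomain13 (Ω : Set H) : Prop :=
  IsOpen Ω ∧ IsConnected Ω ∧ (Ω ∩ Cset).Nonempty ∧
  ∀ J ∈ S1, IsConnected (Ω ∩ hplane J)

/-- `Ω` is `(1,3)`-symmetric: whenever `z + βJ ∈ Ω` (`z ∈ ℂ`, `β ∈ ℝ`, `J ∈ S¹`),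
also `z + βK ∈ Ω` for every `K ∈ S¹`. -/
def IsSymmetric13 (Ω : Set H) : Prop :=
  ∀ z ∈ Cset, ∀ β : ℝ, ∀ J ∈ S1, z + β • J ∈ Ω → ∀ K ∈ S1, z + β • K ∈ Ω

/-- The embedding `ℂ → ℍ`, `a + bi ↦ a + bi`. -/
def embedC (z : ℂ) : H := ⟨z.re, z.im, 0, 0⟩

/-- Partial derivative of `F : ℂ × ℝ → ℍ` in the direction `e`. -/
def pdC (e : ℂ × ℝ) (F : ℂ × ℝ → H) : ℂ × ℝ → H :=
  fun p => fderiv ℝ F p e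

open MeasureTheory Filter Topology Set

/-- Squared Euclidean distance on `ℝ⁴`. -/
def sqDist (y x : Fin 4 → ℝ) : ℝ := ∑ b, (x b - y b) ^ 2

lemma sqDist_nonneg (y x : Fin 4 → ℝ) : 0 ≤ sqDist y x :=
  Finset.sum_nonneg fun _ _ => sq_nonneg _

lemma sqDist_pos {y x : Fin 4 → ℝ} (h : x ≠ y) : 0 < sqDist y x := by
  obtain ⟨b, hb⟩ := Function.ne_iff.1 h
  exact Finset.sum_pos' (fun _ _ => sq_nonneg _)
    ⟨b, Finset.mem_univ b, by have := sub_ne_zero.2 hb; positivity⟩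

lemma contDiff_sqDist (y : Fin 4 → ℝ) {n : WithTop ℕ∞} : ContDiff ℝ n (sqDist y) := by
  unfold sqDist; fun_prop

lemma fderiv_sqDist_single (y x : Fin 4 → ℝ) (a : Fin 4) :
    fderiv ℝ (sqDist y) x (Pi.single a 1) = 2 * (x a - y a) := by
  have h : HasFDerivAt (sqDist y)
      (∑ b, (2 * (x b - y b)) • (ContinuousLinearMap.proj (R := ℝ) (φ := fun _ : Fin 4 => ℝ) b)) x := by
    unfold sqDist
    refine HasFDerivAt.fun_sum fun b _ => ?_
    have := (((ContinuousLinearMap.proj (R := ℝ) (φ := fun _ : Fin 4 => ℝ) b).hasFDerivAt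
      (x := x)).sub_const (y b)).pow 2
    simpa using this
  rw [h.fderiv]
  simp [Pi.single_apply]

/-- The frame `e` identifies `ℝ⁴` isometrically with the quaternions. -/
def IsIsometricFrame (e : Fin 4 → H) : Prop :=
  ∀ x : Fin 4 → ℝ, star (∑ a, x a • e a) * (∑ a, x a • e a) = ((∑ a, x a ^ 2 : ℝ) : H)

/-- The Dirac (Fueter) operator associated with the frame `e`. -/
def dirac (e : Fin 4 → H) (f : (Fin 4 → ℝ) → H) (x : Fin 4 → ℝ) : H :=
  ∑ a, e a * fderiv ℝ f x (Pi.single a 1)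

/-- The image `(Dχ) f` of `f` under the symbol of the Dirac operator at `dχ`. -/
def diracSymbol (e : Fin 4 → H) (χ : (Fin 4 → ℝ) → ℝ) (f : (Fin 4 → ℝ) → H)
    (x : Fin 4 → ℝ) : H :=
  ∑ a, (fderiv ℝ χ x (Pi.single a 1)) • (e a * f x)

/-- The conjugate of the vector from `y` to `x` in the frame `e`. -/
def conjVec (e : Fin 4 → H) (y x : Fin 4 → ℝ) : H := ∑ b, (x b - y b) • star (e b)

lemma contDiff_conjVec (e : Fin 4 → H) (y : Fin 4 → ℝ) {n : WithTop ℕ∞} :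
    ContDiff ℝ n (conjVec e y) := by
  unfold conjVec; fun_prop

lemma fderiv_conjVec_single (e : Fin 4 → H) (y x : Fin 4 → ℝ) (a : Fin 4) :
    fderiv ℝ (conjVec e y) x (Pi.single a 1) = star (e a) := by
  have h : HasFDerivAt (conjVec e y)
      (∑ b, (ContinuousLinearMap.proj (R := ℝ) (φ := fun _ : Fin 4 => ℝ) b).smulRight
        (star (e b))) x := by
    unfold conjVec
    refine HasFDerivAt.fun_sum fun b _ => ?_
    exact (((ContinuousLinearMap.proj (R := ℝ) (φ := fun _ : Fin 4 => ℝ) b).hasFDerivAt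
      (x := x)).sub_const (y b)).smul_const _
  rw [h.fderiv]
  simp only [sum_apply, ContinuousLinearMap.smulRight_apply,
    ContinuousLinearMap.proj_apply]
  rw [Finset.sum_eq_single a] <;> simp +contextual

lemma IsIsometricFrame.star_mul_self {e : Fin 4 → H} (he : IsIsometricFrame e) (a : Fin 4) :
    star (e a) * e a = 1 := by
  have := he (Pi.single a 1)
  simpa [Pi.single_apply] using this

lemma IsIsometricFrame.conjVec_mul {e : Fin 4 → H} (he : IsIsometricFrame e)
    (y x : Fin 4 → ℝ) : conjVec e y x * (∑ a, (x a - y a) • e a) = (sqDist y x : H) := by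
  have := he (x - y)
  simpa [conjVec, sqDist, star_sum] using this

/-- The vector fields whose divergence yields the regularised Cauchy formula. -/
def cauchyField (e : Fin 4 → H) (χ : (Fin 4 → ℝ) → ℝ) (f : (Fin 4 → ℝ) → H) (y : Fin 4 → ℝ)
    (η : ℝ) (a : Fin 4) (x : Fin 4 → ℝ) : H :=
  (χ x * ((sqDist y x + η) ^ 2)⁻¹) • (conjVec e y x * (e a * f x))

lemma differentiableAt_cauchyField {e : Fin 4 → H} {χ : (Fin 4 → ℝ) → ℝ}
    {f : (Fin 4 → ℝ) → H} {y x : Fin 4 → ℝ} {η : ℝ} (hη : 0 < η)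
    (hχ : DifferentiableAt ℝ χ x) (hf : DifferentiableAt ℝ f x) (a : Fin 4) :
    DifferentiableAt ℝ (cauchyField e χ f y η a) x := by
  have h1 := ((contDiff_sqDist y (n := 1)).differentiable (by simp)).differentiableAt (x := x)
  have h2 := ((contDiff_conjVec e y (n := 1)).differentiable (by simp)).differentiableAt (x := x)
  have h3 : (sqDist y x + η) ^ 2 ≠ 0 := by have := sqDist_nonneg y x; positivity
  unfold cauchyField
  fun_prop (disch := assumption)

lemma fderiv_cauchyField_single {e : Fin 4 → H} (he : IsIsometricFrame e) {χ : (Fin 4 → ℝ) → ℝ}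
    {f : (Fin 4 → ℝ) → H} {y x : Fin 4 → ℝ} {η : ℝ} (hη : 0 < η)
    (hχ : DifferentiableAt ℝ χ x) (hf : DifferentiableAt ℝ f x) (a : Fin 4) :
    fderiv ℝ (cauchyField e χ f y η a) x (Pi.single a 1) =
      ((sqDist y x + η) ^ 2)⁻¹ • (conjVec e y x * (fderiv ℝ χ x (Pi.single a 1) • (e a * f x)))
      - (4 * χ x * ((sqDist y x + η) ^ 3)⁻¹) • (conjVec e y x * (((x a - y a) • e a) * f x))
      + (χ x * ((sqDist y x + η) ^ 2)⁻¹) •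
        (f x + conjVec e y x * (e a * fderiv ℝ f x (Pi.single a 1))) := by
  have h0 : sqDist y x + η ≠ 0 := by have := sqDist_nonneg y x; positivity
  have h1 := (((contDiff_sqDist y (n := 1)).differentiable (by simp)).differentiableAt
    (x := x)).hasFDerivAt
  have h2 := (((contDiff_conjVec e y (n := 1)).differentiable (by simp)).differentiableAt
    (x := x)).hasFDerivAt
  have h3 := ((hasDerivAt_inv (pow_ne_zero 2 h0)).comp_hasFDerivAt x ((h1.add_const η).pow 2))
  have h4 := (hχ.hasFDerivAt.mul h3).smul (h2.mul' (hf.hasFDerivAt.const_mul (e a)))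
  have h5 : HasFDerivAt (cauchyField e χ f y η a) _ x := h4
  rw [h5.fderiv]
  have h6 : ∀ v : H, star (e a) * (e a * v) = v := fun v => by
    rw [← mul_assoc, he.star_mul_self, one_mul]
  simp [fderiv_sqDist_single, fderiv_conjVec_single, h6, smul_smul]
  rw [mul_assoc (conjVec e y x)]
  match_scalars <;> field_simp <;> ring

lemma sum_fderiv_cauchyField_single {e : Fin 4 → H} (he : IsIsometricFrame e)
    {χ : (Fin 4 → ℝ) → ℝ}
    {f : (Fin 4 → ℝ) → H} {y x : Fin 4 → ℝ} {η : ℝ} (hη : 0 < η)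
    (hχ : DifferentiableAt ℝ χ x) (hf : DifferentiableAt ℝ f x) (hd : dirac e f x = 0) :
    ∑ a, fderiv ℝ (cauchyField e χ f y η a) x (Pi.single a 1) =
      (4 * η * ((sqDist y x + η) ^ 3)⁻¹) • χ x • f x +
      ((sqDist y x + η) ^ 2)⁻¹ • (conjVec e y x * diracSymbol e χ f x) := by
  have h0 : sqDist y x + η ≠ 0 := by have := sqDist_nonneg y x; positivity
  have h1 : ∑ a, conjVec e y x * (((x a - y a) • e a) * f x) = sqDist y x • f x := by
    rw [← Finset.mul_sum, ← Finset.sum_mul, ← mul_assoc, he.conjVec_mul, coe_mul_eq_smul]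
  have h2 : ∑ a, conjVec e y x * (e a * fderiv ℝ f x (Pi.single a 1)) = 0 := by
    rw [← Finset.mul_sum, ← dirac, hd, mul_zero]
  simp_rw [fderiv_cauchyField_single he hη hχ hf]
  rw [Finset.sum_add_distrib, Finset.sum_sub_distrib, ← Finset.smul_sum, ← Finset.mul_sum,
    ← diracSymbol, ← Finset.smul_sum, ← Finset.smul_sum, Finset.sum_add_distrib, h1, h2]
  simp only [Finset.sum_const, Finset.card_univ, Fintype.card_fin, add_zero, smul_smul,
    ← Nat.cast_smul_eq_nsmul ℝ]
  rw [sub_add_eq_add_sub, add_sub_assoc, ← sub_smul, add_comm]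
  congr 2
  field_simp
  push_cast
  ring

lemma norm_sq_le_sqDist (u : Fin 4 → ℝ) : ‖u‖ ^ 2 ≤ sqDist 0 u := by
  obtain ⟨b, -, hb⟩ := Finset.exists_mem_eq_sup' Finset.univ_nonempty fun b => ‖u b‖₊
  have h : ‖u‖ = ‖u b‖ := by
    rw [Pi.norm_def, ← Finset.sup'_eq_sup Finset.univ_nonempty, hb, coe_nnnorm]
  rw [h, Real.norm_eq_abs, sq_abs]
  simpa [sqDist] using
    Finset.single_le_sum (f := fun b => u b ^ 2) (fun _ _ => sq_nonneg _) (Finset.mem_univ b)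

lemma integral_box_cauchy_eq_zero {e : Fin 4 → H} (he : IsIsometricFrame e)
    {χ : (Fin 4 → ℝ) → ℝ} {f : (Fin 4 → ℝ) → H} {y₀ : Fin 4 → ℝ} {R : ℝ} (hR : 0 < R)
    (hχ : ContDiff ℝ 1 χ) (hχ0 : ∀ x, x ∉ Metric.ball y₀ R → χ x = 0)
    (hf : ∀ x ∈ Metric.closedBall y₀ R, DifferentiableAt ℝ f x)
    (hd : ∀ x ∈ Metric.closedBall y₀ R, dirac e f x = 0)
    (y : Fin 4 → ℝ) {η : ℝ} (hη : 0 < η) :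
    ∫ x in Metric.closedBall y₀ R, ((4 * η * ((sqDist y x + η) ^ 3)⁻¹) • χ x • f x +
      ((sqDist y x + η) ^ 2)⁻¹ • (conjVec e y x * diracSymbol e χ f x)) = 0 := by
  have hbox : Metric.closedBall y₀ R = Icc (fun i => y₀ i - R) (fun i => y₀ i + R) := by
    rw [closedBall_pi _ hR.le, ← Set.pi_univ_Icc]
    simp [Real.closedBall_eq_Icc]
  have hχd : Differentiable ℝ χ := hχ.differentiable (by simp)
  have hdiff : ∀ x ∈ Metric.closedBall y₀ R, ∀ a,
      DifferentiableAt ℝ (cauchyField e χ f y η a) x :=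
    fun x hx a => differentiableAt_cauchyField hη (hχd x) (hf x hx) a
  have hsum : ∀ x ∈ Metric.closedBall y₀ R, _ := fun x hx =>
    sum_fderiv_cauchyField_single he (y := y) hη (hχd x) (hf x hx) (hd x hx)
  have hfc : ContinuousOn f (Metric.closedBall y₀ R) :=
    fun x hx => (hf x hx).continuousAt.continuousWithinAt
  have hχ' : Continuous (fderiv ℝ χ) := hχ.continuous_fderiv (by simp)
  have hcont : ContinuousOn (fun x => (4 * η * ((sqDist y x + η) ^ 3)⁻¹) • χ x • f x +
      ((sqDist y x + η) ^ 2)⁻¹ • (conjVec e y x * diracSymbol e χ f x))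
      (Metric.closedBall y₀ R) := by
    have h1 : Continuous (sqDist y) := (contDiff_sqDist y (n := 0)).continuous
    have h2 : Continuous (conjVec e y) := (contDiff_conjVec e y (n := 0)).continuous
    have h3 : ∀ x, sqDist y x + η ≠ 0 := fun x => by have := sqDist_nonneg y x; positivity
    have h4 : ∀ n : ℕ, Continuous fun x => ((sqDist y x + η) ^ n)⁻¹ := fun n =>
      ((h1.add continuous_const).pow n).inv₀ fun x => pow_ne_zero n (h3 x)
    have h5 := hχd.continuous
    have h6 : ContinuousOn (diracSymbol e χ f) (Metric.closedBall y₀ R) := by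
      unfold diracSymbol
      fun_prop
    refine ContinuousOn.add ?_ ?_
    · exact (continuous_const.mul (h4 3)).continuousOn.smul (h5.continuousOn.smul hfc)
    · exact (h4 2).continuousOn.smul (h2.continuousOn.mul h6)
  have hzero : ∀ a x, x ∉ Metric.ball y₀ R → cauchyField e χ f y η a x = 0 := fun a x hx => by
    simp [cauchyField, hχ0 x hx]
  have key := integral_divergence_of_hasFDerivAt_off_countable' (n := 3)
    (fun i => y₀ i - R) (fun i => y₀ i + R) (fun i => by dsimp only; linarith)
    (cauchyField e χ f y η) (fun a => fderiv ℝ (cauchyField e χ f y η a)) ∅ countable_empty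
    (fun a => hbox ▸ fun x hx => (hdiff x hx a).continuousAt.continuousWithinAt)
    (fun x hx a => (hdiff x (hbox ▸ ⟨fun i => (hx.1 i (mem_univ i)).1.le,
      fun i => (hx.1 i (mem_univ i)).2.le⟩) a).hasFDerivAt)
    (by
      rw [← hbox]
      exact (hcont.congr hsum).integrableOn_compact (isCompact_closedBall _ _))
  rw [← hbox] at key
  rw [← setIntegral_congr_fun measurableSet_closedBall hsum, key]
  refine Finset.sum_eq_zero fun a _ => ?_
  have hface : ∀ (t : ℝ) (x : Fin 3 → ℝ), |t - y₀ a| = R →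
      a.insertNth (α := fun _ => ℝ) t x ∉ Metric.ball y₀ R := fun t x ht hx => by
    have h := dist_le_pi_dist (a.insertNth (α := fun _ => ℝ) t x) y₀ a
    rw [Fin.insertNth_apply_same, Real.dist_eq, ht] at h
    exact absurd (Metric.mem_ball.1 hx) (not_lt.2 h)
  rw [setIntegral_eq_zero_of_forall_eq_zero, setIntegral_eq_zero_of_forall_eq_zero, sub_zero]
  · exact fun x _ => hzero a _ (hface _ x (by simp [abs_of_pos hR]))
  · exact fun x _ => hzero a _ (hface _ x (by simp [abs_of_pos hR]))

/-- The profile of the approximate identity obtained from the regularised Newton kernel is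
integrable. -/
lemma integrable_bump_profile :
    Integrable (fun u : Fin 4 → ℝ => 4 * ((sqDist 0 u + 1) ^ 3)⁻¹) := by
  have h1 : Continuous (sqDist 0) := (contDiff_sqDist 0 (n := 0)).continuous
  have h3 : ∀ x, sqDist 0 x + 1 ≠ 0 := fun x => by have := sqDist_nonneg 0 x; positivity
  have hc : Continuous fun u => ((sqDist 0 u + 1) ^ 3)⁻¹ :=
    ((h1.add continuous_const).pow 3).inv₀ fun x => pow_ne_zero 3 (h3 x)
  refine Integrable.const_mul ?_ 4
  refine (integrable_rpow_neg_one_add_norm_sq (E := Fin 4 → ℝ) (μ := volume) (r := 6)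
    (by simp; norm_num)).mono' hc.aestronglyMeasurable (Eventually.of_forall fun u => ?_)
  have hn := norm_sq_le_sqDist u
  have : (1 + ‖u‖ ^ 2) ^ (-6 / 2 : ℝ) = ((‖u‖ ^ 2 + 1) ^ 3)⁻¹ := by
    rw [show (-6 / 2 : ℝ) = -(3 : ℕ) by norm_num, Real.rpow_neg (by positivity),
      Real.rpow_natCast, add_comm]
  rw [this, Real.norm_of_nonneg (by have := sqDist_nonneg 0 u; positivity)]
  gcongr

lemma integral_bump_profile_pos :
    0 < ∫ u : Fin 4 → ℝ, 4 * ((sqDist 0 u + 1) ^ 3)⁻¹ := by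
  have h1 : Continuous (sqDist 0) := (contDiff_sqDist 0 (n := 0)).continuous
  have h3 : ∀ x, sqDist 0 x + 1 ≠ 0 := fun x => by have := sqDist_nonneg 0 x; positivity
  have hc : Continuous fun u => ((sqDist 0 u + 1) ^ 3)⁻¹ :=
    ((h1.add continuous_const).pow 3).inv₀ fun x => pow_ne_zero 3 (h3 x)
  refine integral_pos_of_integrable_nonneg_nonzero (x := 0) (by fun_prop)
    integrable_bump_profile (fun u => ?_) ?_
  · have := sqDist_nonneg 0 u; positivity
  · simp [sqDist]

lemma tendsto_integral_bump {g : (Fin 4 → ℝ) → H} (hg : Integrable g) {y : Fin 4 → ℝ}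
    (hgy : ContinuousAt g y) :
    Tendsto (fun c : ℝ => ∫ x, (4 * (c⁻¹ ^ 2) * ((sqDist y x + c⁻¹ ^ 2) ^ 3)⁻¹) • g x) atTop
      (𝓝 ((∫ u : Fin 4 → ℝ, 4 * ((sqDist 0 u + 1) ^ 3)⁻¹) • g y)) := by
  set I := ∫ u : Fin 4 → ℝ, 4 * ((sqDist 0 u + 1) ^ 3)⁻¹ with hI
  have hIpos : 0 < I := integral_bump_profile_pos
  have key := tendsto_integral_comp_smul_smul_of_integrable' (μ := volume)
    (φ := fun u : Fin 4 → ℝ => I⁻¹ * (4 * ((sqDist 0 u + 1) ^ 3)⁻¹))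
    (fun u => by have := sqDist_nonneg 0 u; positivity)
    (by rw [integral_const_mul, ← hI, inv_mul_cancel₀ hIpos.ne']) ?_ hg hgy
  · refine (key.const_smul I).congr' ?_
    filter_upwards [eventually_gt_atTop 0] with c hc
    rw [← integral_smul]
    refine integral_congr_ae (.of_forall fun x => ?_)
    dsimp only
    rw [smul_smul]
    congr 1
    have : sqDist 0 (c • (y - x)) = c ^ 2 * sqDist y x := by
      simp only [sqDist, Finset.mul_sum]
      refine Finset.sum_congr rfl fun b _ => ?_
      simp
      ring
    have h0 := sqDist_nonneg y x
    rw [this]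
    simp only [Module.finrank_fintype_fun_eq_card, Fintype.card_fin]
    have h2 : c ^ 2 * sqDist y x + 1 ≠ 0 := by positivity
    have h3 : sqDist y x + c⁻¹ ^ 2 ≠ 0 := by positivity
    have h4 : sqDist y x + c⁻¹ ^ 2 = (c ^ 2 * sqDist y x + 1) * c⁻¹ ^ 2 := by
      field_simp
    rw [h4]
    field_simp
  · have hlim : Tendsto (fun x : Fin 4 → ℝ => I⁻¹ * 4 * (‖x‖ ^ 2 + 1)⁻¹)
        (Bornology.cobounded _) (𝓝 0) := by
      have := tendsto_inv_atTop_zero.comp (tendsto_atTop_add_const_right _ (1 : ℝ)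
        ((tendsto_pow_atTop (two_ne_zero)).comp
          (tendsto_norm_cobounded_atTop (E := Fin 4 → ℝ))))
      simpa using this.const_mul (I⁻¹ * 4)
    refine squeeze_zero (fun x => by have := sqDist_nonneg 0 x; positivity) (fun x => ?_) hlim
    have hn := norm_sq_le_sqDist x
    calc ‖x‖ ^ Module.finrank ℝ (Fin 4 → ℝ) * (I⁻¹ * (4 * ((sqDist 0 x + 1) ^ 3)⁻¹))
        = I⁻¹ * 4 * ((‖x‖ ^ 2) ^ 2 * ((sqDist 0 x + 1) ^ 3)⁻¹) := by
          simp only [Module.finrank_fintype_fun_eq_card, Fintype.card_fin]; ring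
      _ ≤ I⁻¹ * 4 * ((‖x‖ ^ 2 + 1) ^ 2 * ((‖x‖ ^ 2 + 1) ^ 3)⁻¹) := by
          have := sqDist_nonneg 0 x
          gcongr
          linarith
      _ = I⁻¹ * 4 * (‖x‖ ^ 2 + 1)⁻¹ := by
          have : ‖x‖ ^ 2 + 1 ≠ 0 := by positivity
          field_simp

section CauchyKernel

variable (K : Set (Fin 4 → ℝ))

/-- The coordinate functions on `K`. -/
def coordMap (b : Fin 4) : C(K, ℝ) :=
  ⟨fun x => x.1 b, (continuous_apply b).comp continuous_subtype_val⟩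

/-- `x ↦ |x - y|² + η` as a continuous function on `K`. -/
def regSqDist (p : (Fin 4 → ℝ) × ℝ) : C(K, ℝ) :=
  ∑ b, (coordMap K b - p.1 b • 1) ^ 2 + p.2 • 1

/-- The components `x ↦ (x_b - y_b) / (|x - y|² + η)²` of the regularised Cauchy kernel. -/
def cauchyKernel (b : Fin 4) (p : (Fin 4 → ℝ) × ℝ) : C(K, ℝ) :=
  (coordMap K b - p.1 b • 1) * Ring.inverse (regSqDist K p) ^ 2

lemma regSqDist_apply (p : (Fin 4 → ℝ) × ℝ) (x : K) :
    regSqDist K p x = sqDist p.1 x + p.2 := by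
  simp [regSqDist, sqDist, coordMap]

lemma isUnit_regSqDist {p : (Fin 4 → ℝ) × ℝ} (hp : p.1 ∉ K ∧ 0 ≤ p.2 ∨ 0 < p.2) :
    IsUnit (regSqDist K p) := by
  rw [ContinuousMap.isUnit_iff_forall_ne_zero]
  intro x
  rw [regSqDist_apply]
  rcases hp with ⟨h, h'⟩ | h
  · have := sqDist_pos (y := p.1) (x := x) (fun hx => h (hx ▸ x.2))
    positivity
  · have := sqDist_nonneg p.1 x
    positivity

lemma ringInverse_continuousMap_apply {X : Type*} [TopologicalSpace X] {u : C(X, ℝ)}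
    (hu : IsUnit u) (x : X) : Ring.inverse u x = (u x)⁻¹ := by
  have := congrArg (fun v : C(X, ℝ) => v x) (Ring.mul_inverse_cancel u hu)
  exact eq_inv_of_mul_eq_one_right (by simpa using this)

lemma cauchyKernel_apply {p : (Fin 4 → ℝ) × ℝ} (hp : p.1 ∉ K ∧ 0 ≤ p.2 ∨ 0 < p.2) (b : Fin 4)
    (x : K) : cauchyKernel K b p x = (x.1 b - p.1 b) * ((sqDist p.1 x + p.2) ^ 2)⁻¹ := by
  simp [cauchyKernel, ringInverse_continuousMap_apply (isUnit_regSqDist K hp), regSqDist_apply,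
    coordMap]

lemma analyticAt_coordMap_sub [CompactSpace K] (b : Fin 4) (p : (Fin 4 → ℝ) × ℝ) :
    AnalyticAt ℝ (fun p : (Fin 4 → ℝ) × ℝ => coordMap K b - p.1 b • (1 : C(K, ℝ))) p :=
  analyticAt_const.sub ((((ContinuousLinearMap.proj (R := ℝ) (φ := fun _ : Fin 4 => ℝ) b).comp
    (ContinuousLinearMap.fst ℝ (Fin 4 → ℝ) ℝ)).analyticAt p).smul analyticAt_const)

lemma analyticAt_regSqDist [CompactSpace K] (p : (Fin 4 → ℝ) × ℝ) :
    AnalyticAt ℝ (regSqDist K) p := by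
  unfold regSqDist
  exact (Finset.analyticAt_fun_sum _ fun b _ => (analyticAt_coordMap_sub K b p).pow 2).add
    (analyticAt_snd.smul analyticAt_const)

lemma analyticAt_cauchyKernel [CompactSpace K] (b : Fin 4) {p : (Fin 4 → ℝ) × ℝ}
    (hp : p.1 ∉ K ∧ 0 ≤ p.2 ∨ 0 < p.2) : AnalyticAt ℝ (cauchyKernel K b) p := by
  have h := (analyticAt_inverse (𝕜 := ℝ) (isUnit_regSqDist K hp).unit).comp_of_eq
    (analyticAt_regSqDist K p) rfl
  exact (analyticAt_coordMap_sub K b p).mul (h.pow 2)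

/-- Integration over `K` against a continuous density. -/
lemma exists_integral_clm (hK : IsCompact K) [CompactSpace K] {w : (Fin 4 → ℝ) → H}
    (hw : ContinuousOn w K) :
    ∃ L : C(K, ℝ) →L[ℝ] H, ∀ (h : C(K, ℝ)) (k : (Fin 4 → ℝ) → ℝ), (∀ x : K, h x = k x) →
      L h = ∫ x in K, k x • w x := by
  have hwi : IntegrableOn w K := hw.integrableOn_compact hK
  set μ : Measure K := volume.comap Subtype.val
  have hwμ : Integrable (fun x : K => w x) μ :=
    (integrableOn_iff_comap_subtypeVal hK.measurableSet).1 hwi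
  have hi : ∀ h : C(K, ℝ), Integrable (fun x : K => h x • w x) μ := fun h =>
    hwμ.bdd_smul ‖h‖ h.continuous.aestronglyMeasurable (.of_forall h.norm_coe_le_norm)
  refine ⟨LinearMap.mkContinuous
    { toFun := fun h => ∫ x, h x • w x ∂μ
      map_add' := fun h h' => by
        simp_rw [ContinuousMap.add_apply, add_smul]
        exact integral_add (hi h) (hi h')
      map_smul' := fun r h => by
        simp_rw [ContinuousMap.smul_apply, smul_assoc]
        exact integral_smul _ _ } (∫ x, ‖w x‖ ∂μ) fun h => ?_, fun h k hk => ?_⟩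
  · refine (norm_integral_le_integral_norm _).trans ?_
    rw [mul_comm, ← integral_const_mul]
    refine integral_mono (hi h).norm (hwμ.norm.const_mul _) fun x => ?_
    simp only [norm_smul]
    gcongr
    exact h.norm_coe_le_norm x
  · simp only [LinearMap.mkContinuous_apply, LinearMap.coe_mk, AddHom.coe_mk, hk]
    exact integral_subtype_comap hK.measurableSet fun x => k x • w x

end CauchyKernel

/-- Cauchy integral formula for Fueter-regular functions, with the kernel valued in the Banach
algebra of continuous functions on a compact set avoiding the base point. -/
theorem exists_cauchy_representation {e : Fin 4 → H} (he : IsIsometricFrame e)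
    {f : (Fin 4 → ℝ) → H} {y₀ : Fin 4 → ℝ}
    (hf : ∀ᶠ x in 𝓝 y₀, DifferentiableAt ℝ f x ∧ dirac e f x = 0) :
    ∃ K : Set (Fin 4 → ℝ), IsCompact K ∧ y₀ ∉ K ∧ ∃ (_ : CompactSpace K) (L : C(K, ℝ) →L[ℝ] H),
      ∀ᶠ y in 𝓝 y₀, f y = ∑ b, star (e b) * L (cauchyKernel K b (y, 0)) := by
  obtain ⟨R, hR, hRf⟩ := Metric.nhds_basis_closedBall.eventually_iff.1 hf
  let χ : ContDiffBump y₀ := ⟨R / 3, 2 * R / 3, by positivity, by linarith⟩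
  have hχ : ContDiff ℝ 1 χ := χ.contDiff
  have hχ0 : ∀ x, x ∉ Metric.ball y₀ (2 * R / 3) → χ x = 0 := fun x hx =>
    χ.zero_of_le_dist (not_lt.1 hx)
  have hχ0' : ∀ x, x ∉ Metric.ball y₀ R → χ x = 0 := fun x hx =>
    hχ0 x fun h => hx (Metric.ball_subset_ball (by linarith) h)
  have hχ1 : ∀ x ∈ Metric.ball y₀ (R / 3), χ x = 1 := fun x hx =>
    χ.one_of_mem_closedBall (Metric.ball_subset_closedBall hx)
  have hw0 : ∀ x ∈ Metric.ball y₀ (R / 3), diracSymbol e χ f x = 0 := fun x hx => by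
    have h : (χ : (Fin 4 → ℝ) → ℝ) =ᶠ[𝓝 x] fun _ => 1 :=
      eventually_of_mem (Metric.isOpen_ball.mem_nhds hx) hχ1
    simp [diracSymbol, h.fderiv_eq]
  have hfc : ContinuousOn f (Metric.closedBall y₀ R) :=
    fun x hx => (hRf hx).1.continuousAt.continuousWithinAt
  have hχ' : Continuous (fderiv ℝ χ) := hχ.continuous_fderiv (by simp)
  have hχc : Continuous χ := hχ.continuous
  have hw : ContinuousOn (diracSymbol e χ f) (Metric.closedBall y₀ R) := by
    unfold diracSymbol
    fun_prop
  set K := Metric.closedBall y₀ R \ Metric.ball y₀ (R / 3) with hKdef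
  have hK : IsCompact K := (isCompact_closedBall y₀ R).diff Metric.isOpen_ball
  have : CompactSpace K := isCompact_iff_compactSpace.1 hK
  obtain ⟨L, hL⟩ := exists_integral_clm K hK (hw.mono sdiff_subset)
  have hgc : Continuous fun x => χ x • f x := by
    refine continuous_iff_continuousAt.2 fun x => ?_
    by_cases hx : x ∈ Metric.ball y₀ R
    · exact hχc.continuousAt.smul (hRf (Metric.ball_subset_closedBall hx)).1.continuousAt
    · have hx' : x ∈ (Metric.closedBall y₀ (2 * R / 3))ᶜ := fun h =>
        hx (Metric.closedBall_subset_ball (by linarith) h)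
      refine (continuousAt_const (y := (0 : H))).congr ?_
      filter_upwards [Metric.isClosed_closedBall.isOpen_compl.mem_nhds hx'] with z hz
      rw [hχ0 z fun h => hz (Metric.ball_subset_closedBall h), zero_smul]
  have hgs : ∀ x, x ∉ Metric.closedBall y₀ R → χ x • f x = 0 := fun x hx => by
    rw [hχ0' x fun h => hx (Metric.ball_subset_closedBall h), zero_smul]
  have hgi : Integrable fun x => χ x • f x :=
    hgc.integrable_of_hasCompactSupport
      (HasCompactSupport.intro (isCompact_closedBall y₀ R) fun x hx => hgs x hx)
  have hreg : ∀ y (η : ℝ), 0 < η →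
      ∫ x, (4 * η * ((sqDist y x + η) ^ 3)⁻¹) • χ x • f x =
        -∑ b, star (e b) * L (cauchyKernel K b (y, η)) := by
    intro y η hη
    have key := integral_box_cauchy_eq_zero he hR hχ hχ0' (fun x hx => (hRf hx).1)
      (fun x hx => (hRf hx).2) y hη
    have h1 : Continuous (sqDist y) := (contDiff_sqDist y (n := 0)).continuous
    have h2 : Continuous (conjVec e y) := (contDiff_conjVec e y (n := 0)).continuous
    have h3 : ∀ x, sqDist y x + η ≠ 0 := fun x => by have := sqDist_nonneg y x; positivity
    have h4 : ∀ n : ℕ, Continuous fun x => ((sqDist y x + η) ^ n)⁻¹ := fun n =>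
      ((h1.add continuous_const).pow n).inv₀ fun x => pow_ne_zero n (h3 x)
    have hB : ContinuousOn (fun x =>
        ((sqDist y x + η) ^ 2)⁻¹ • (conjVec e y x * diracSymbol e χ f x))
        (Metric.closedBall y₀ R) := (h4 2).continuousOn.smul (h2.continuousOn.mul hw)
    have hA : Continuous fun x => (4 * η * ((sqDist y x + η) ^ 3)⁻¹) • χ x • f x :=
      (continuous_const.mul (h4 3)).smul hgc
    rw [integral_add (hA.continuousOn.integrableOn_compact (isCompact_closedBall _ _))
      (hB.integrableOn_compact (isCompact_closedBall _ _))] at key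
    rw [setIntegral_eq_integral_of_forall_compl_eq_zero fun x hx => by
      rw [hgs x hx, smul_zero]] at key
    rw [eq_neg_of_add_eq_zero_left key, neg_inj]
    have hKsub : ∫ x in Metric.closedBall y₀ R,
        ((sqDist y x + η) ^ 2)⁻¹ • (conjVec e y x * diracSymbol e χ f x) =
        ∫ x in K, ((sqDist y x + η) ^ 2)⁻¹ • (conjVec e y x * diracSymbol e χ f x) := by
      refine (setIntegral_eq_of_subset_of_forall_sdiff_eq_zero measurableSet_closedBall
        sdiff_subset fun x hx => ?_)
      have : x ∈ Metric.ball y₀ (R / 3) := by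
        by_contra h
        exact hx.2 ⟨hx.1, h⟩
      rw [hw0 x this, mul_zero, smul_zero]
    rw [hKsub]
    have hLb : ∀ b, L (cauchyKernel K b (y, η)) = ∫ x in K,
        ((x b - y b) * ((sqDist y x + η) ^ 2)⁻¹) • diracSymbol e χ f x := fun b =>
      hL _ _ fun x => cauchyKernel_apply K (.inr hη) b x
    have hint : ∀ b, IntegrableOn (fun x =>
        ((x b - y b) * ((sqDist y x + η) ^ 2)⁻¹) • diracSymbol e χ f x) K := fun b =>
      ContinuousOn.integrableOn_compact hK
        (((by fun_prop : Continuous fun x : Fin 4 → ℝ => x b - y b).mul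
          (h4 2)).continuousOn.smul (hw.mono sdiff_subset))
    simp_rw [hLb]
    rw [← Finset.sum_congr rfl fun b _ => integral_const_mul_of_integrable (hint b),
      ← integral_finsetSum _ fun b _ => (hint b).const_mul _]
    refine integral_congr_ae (.of_forall fun x => ?_)
    simp only [conjVec, Finset.sum_mul, Finset.smul_sum]
    refine Finset.sum_congr rfl fun b _ => ?_
    rw [smul_mul_assoc, smul_smul, mul_smul_comm, mul_comm]
  set I := ∫ u : Fin 4 → ℝ, 4 * ((sqDist 0 u + 1) ^ 3)⁻¹ with hI
  have hIpos : 0 < I := integral_bump_profile_pos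
  have hy₀K : ∀ y ∈ Metric.ball y₀ (R / 3), y ∉ K := fun y hy h => h.2 hy
  refine ⟨K, hK, hy₀K y₀ (Metric.mem_ball_self (by positivity)), this, -(I⁻¹ • L), ?_⟩
  filter_upwards [Metric.ball_mem_nhds y₀ (by positivity : 0 < R / 3)] with y hy
  have hlim1 := tendsto_integral_bump hgi (y := y) hgc.continuousAt
  have hsq : Tendsto (fun c : ℝ => c⁻¹ ^ 2) atTop (𝓝 0) := by
    simpa only [zero_pow two_ne_zero] using (tendsto_inv_atTop_zero (𝕜 := ℝ)).pow 2
  have hlim2 : Tendsto (fun c : ℝ => -∑ b, star (e b) * L (cauchyKernel K b (y, c⁻¹ ^ 2)))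
      atTop (𝓝 (-∑ b, star (e b) * L (cauchyKernel K b (y, 0)))) := by
    refine (tendsto_finsetSum _ fun b _ => Tendsto.const_mul _ ?_).neg
    have hc : ContinuousAt (cauchyKernel K b) (y, 0) :=
      (analyticAt_cauchyKernel K b (.inl ⟨hy₀K y hy, le_rfl⟩)).continuousAt
    exact (L.continuous.continuousAt.tendsto.comp hc.tendsto).comp
      (tendsto_const_nhds.prodMk_nhds hsq)
  have heq := tendsto_nhds_unique hlim1 (hlim2.congr' (by
    filter_upwards [eventually_gt_atTop 0] with c hc
    exact (hreg y _ (by positivity)).symm))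
  rw [← hI, hχ1 y hy, one_smul] at heq
  rw [← inv_smul_smul₀ hIpos.ne' (f y), heq, smul_neg, Finset.smul_sum, ← Finset.sum_neg_distrib]
  refine Finset.sum_congr rfl fun b _ => ?_
  simp

lemma analyticAt_of_dirac_eq_zero {e : Fin 4 → H} (he : IsIsometricFrame e)
    {f : (Fin 4 → ℝ) → H} {y₀ : Fin 4 → ℝ}
    (hf : ∀ᶠ x in 𝓝 y₀, DifferentiableAt ℝ f x ∧ dirac e f x = 0) : AnalyticAt ℝ f y₀ := by
  obtain ⟨K, -, hy₀, _, L, hL⟩ := exists_cauchy_representation he hf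
  refine AnalyticAt.congr (Finset.analyticAt_fun_sum _ fun b _ => ?_) (EventuallyEq.symm hL)
  have h1 : AnalyticAt ℝ (fun y : Fin 4 → ℝ => (y, (0 : ℝ))) y₀ :=
    analyticAt_id.prod analyticAt_const
  have h2 := (analyticAt_cauchyKernel K b (.inl ⟨hy₀, le_rfl⟩)).comp_of_eq h1 rfl
  exact analyticAt_const.mul ((L.analyticAt _).comp h2)

section Parity

variable (K : Set (Fin 4 → ℝ))

/-- The point of `ℝ⁴` over `(x₀, x₁)`. -/
def planePoint (u : ℝ × ℝ × ℝ) : Fin 4 → ℝ := ![u.1, u.2.1, 0, 0]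

lemma regSqDist_parity (u : ℝ × ℝ × ℝ) :
    regSqDist K (![u.1, u.2.1, u.2.2, 0], 0) =
      regSqDist K (planePoint u, u.2.2 ^ 2) - (2 * u.2.2) • coordMap K 2 := by
  ext x
  simp [regSqDist, planePoint, Fin.sum_univ_four]
  ring

/-- The product of `|x - y|²` over the two points `y = (x₀, x₁, ±√t, 0)`. -/
def evenDenominator (u : ℝ × ℝ × ℝ) : C(K, ℝ) :=
  regSqDist K (planePoint u, u.2.2) ^ 2 - (4 * u.2.2) • coordMap K 2 ^ 2

/-- The even part in `β` of the Cauchy kernel, as a function of `(x₀, x₁, β²)`. -/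
def evenKernel (b : Fin 4) (u : ℝ × ℝ × ℝ) : C(K, ℝ) :=
  ((coordMap K b - planePoint u b • 1) *
      (regSqDist K (planePoint u, u.2.2) ^ 2 + (4 * u.2.2) • coordMap K 2 ^ 2)
    - (4 * u.2.2 * (Pi.single 2 1 : Fin 4 → ℝ) b) •
      (regSqDist K (planePoint u, u.2.2) * coordMap K 2)) *
    Ring.inverse (evenDenominator K u) ^ 2

/-- The odd part in `β` of the Cauchy kernel, divided by `β`, as a function of
`(x₀, x₁, β²)`. -/
def oddKernel (b : Fin 4) (u : ℝ × ℝ × ℝ) : C(K, ℝ) :=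
  ((4 : ℝ) • ((coordMap K b - planePoint u b • 1) *
      (regSqDist K (planePoint u, u.2.2) * coordMap K 2))
    - ((Pi.single 2 1 : Fin 4 → ℝ) b) •
      (regSqDist K (planePoint u, u.2.2) ^ 2 + (4 * u.2.2) • coordMap K 2 ^ 2)) *
    Ring.inverse (evenDenominator K u) ^ 2

lemma cauchyKernel_parity (b : Fin 4) (u : ℝ × ℝ × ℝ)
    (h : ![u.1, u.2.1, u.2.2, 0] ∉ K) (h' : ![u.1, u.2.1, -u.2.2, 0] ∉ K) :
    cauchyKernel K b (![u.1, u.2.1, u.2.2, 0], 0) =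
      evenKernel K b (u.1, u.2.1, u.2.2 ^ 2) + u.2.2 • oddKernel K b (u.1, u.2.1, u.2.2 ^ 2) := by
  have hQ := isUnit_regSqDist K (p := (![u.1, u.2.1, u.2.2, 0], 0)) (.inl ⟨h, le_rfl⟩)
  have hQ' := isUnit_regSqDist K (p := (![u.1, u.2.1, -u.2.2, 0], 0)) (.inl ⟨h', le_rfl⟩)
  have e1 := regSqDist_parity K u
  have e2 := regSqDist_parity K (u.1, u.2.1, -u.2.2)
  simp only at e2
  have hP : evenDenominator K (u.1, u.2.1, u.2.2 ^ 2) =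
      regSqDist K (![u.1, u.2.1, u.2.2, 0], 0) * regSqDist K (![u.1, u.2.1, -u.2.2, 0], 0) := by
    rw [e1, e2]
    ext x
    simp [evenDenominator, planePoint]
    ring
  have hPu : IsUnit (evenDenominator K (u.1, u.2.1, u.2.2 ^ 2)) := hP ▸ hQ.mul hQ'
  ext x
  have hPx := (ContinuousMap.isUnit_iff_forall_ne_zero _).1 hPu x
  have hQx := (ContinuousMap.isUnit_iff_forall_ne_zero _).1 hQ x
  have hQx' := (ContinuousMap.isUnit_iff_forall_ne_zero _).1 hQ' x
  have e1x := congrArg (fun v : C(K, ℝ) => v x) e1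
  have e2x := congrArg (fun v : C(K, ℝ) => v x) e2
  have hPe := congrArg (fun v : C(K, ℝ) => v x) hP
  simp only [ContinuousMap.mul_apply, ContinuousMap.sub_apply, ContinuousMap.smul_apply,
    smul_eq_mul, planePoint, neg_sq] at e1x e2x hPe
  have hb : (![u.1, u.2.1, u.2.2, 0] : Fin 4 → ℝ) b =
      planePoint (u.1, u.2.1, u.2.2 ^ 2) b + u.2.2 * (Pi.single 2 1 : Fin 4 → ℝ) b := by
    fin_cases b <;> simp [planePoint]
  simp only [cauchyKernel, evenKernel, oddKernel, ContinuousMap.mul_apply,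
    ContinuousMap.sub_apply, ContinuousMap.add_apply, ContinuousMap.smul_apply,
    ContinuousMap.pow_apply, ContinuousMap.one_apply, smul_eq_mul,
    ringInverse_continuousMap_apply hQ, ringInverse_continuousMap_apply hPu, hb]
  rw [hPe] at hPx ⊢
  simp only [planePoint]
  generalize regSqDist K (![u.1, u.2.1, u.2.2, 0], 0) x = q at *
  generalize regSqDist K (![u.1, u.2.1, -u.2.2, 0], 0) x = q' at *
  generalize regSqDist K (![u.1, u.2.1, 0, 0], u.2.2 ^ 2) x = a at *
  have ha : a = q' - 2 * u.2.2 * coordMap K 2 x := by rw [e2x]; ring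
  have hq : q = q' - 4 * u.2.2 * coordMap K 2 x := by rw [e1x, ha]; ring
  field_simp
  rw [ha]
  ring

variable [CompactSpace K]

lemma analyticAt_planePoint (u : ℝ × ℝ × ℝ) : AnalyticAt ℝ planePoint u := by
  rw [analyticAt_pi_iff]
  intro b
  have h1 : AnalyticAt ℝ (fun u : ℝ × ℝ × ℝ => u.2.1) u := analyticAt_fst.comp analyticAt_snd
  fin_cases b
  · exact analyticAt_fst
  · exact h1
  · exact analyticAt_const
  · exact analyticAt_const

lemma analyticAt_parityKernels (b : Fin 4) {u : ℝ × ℝ × ℝ} (hu : u.2.2 = 0)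
    (h : planePoint u ∉ K) :
    AnalyticAt ℝ (evenKernel K b) u ∧ AnalyticAt ℝ (oddKernel K b) u := by
  have ht : AnalyticAt ℝ (fun u : ℝ × ℝ × ℝ => u.2.2) u := analyticAt_snd.comp analyticAt_snd
  have hv := analyticAt_planePoint u
  have hvb : AnalyticAt ℝ (fun u => planePoint u b) u := analyticAt_pi_iff.1 hv b
  have ha : AnalyticAt ℝ (fun u => regSqDist K (planePoint u, u.2.2)) u :=
    (analyticAt_regSqDist K _).comp_of_eq (hv.prod ht) rfl
  have h4t : AnalyticAt ℝ (fun u : ℝ × ℝ × ℝ => (4 * u.2.2) • coordMap K 2 ^ 2) u :=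
    (analyticAt_const.mul ht).smul analyticAt_const
  have hP : AnalyticAt ℝ (evenDenominator K) u := (ha.pow 2).sub h4t
  have hPu : IsUnit (evenDenominator K u) := by
    simpa [evenDenominator, hu] using (isUnit_regSqDist K (p := (planePoint u, 0))
      (.inl ⟨h, le_rfl⟩)).pow 2
  have hinv := ((analyticAt_inverse (𝕜 := ℝ) hPu.unit).comp_of_eq hP rfl).pow 2
  have hc : AnalyticAt ℝ (fun u => coordMap K b - planePoint u b • (1 : C(K, ℝ))) u :=
    analyticAt_const.sub (hvb.smul analyticAt_const)
  exact ⟨((hc.mul ((ha.pow 2).add h4t)).sub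
      (((analyticAt_const.mul ht).mul analyticAt_const).smul (ha.mul analyticAt_const))).mul hinv,
    (((analyticAt_const (v := (4 : ℝ))).smul (hc.mul (ha.mul analyticAt_const))).sub
      ((analyticAt_const (v := (Pi.single 2 1 : Fin 4 → ℝ) b)).smul ((ha.pow 2).add h4t))).mul hinv⟩

end Parity

/-- A Fueter-regular function splits near the mirror into even and odd parts in `β` that are
analytic in `β²`. -/
lemma exists_analyticAt_parity {e : Fin 4 → H} (he : IsIsometricFrame e)
    {f : (Fin 4 → ℝ) → H} {u₀ : ℝ × ℝ × ℝ} (hu₀ : u₀.2.2 = 0)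
    (hf : ∀ᶠ x in 𝓝 (planePoint u₀), DifferentiableAt ℝ f x ∧ dirac e f x = 0) :
    ∃ A B : ℝ × ℝ × ℝ → H, AnalyticAt ℝ A u₀ ∧ AnalyticAt ℝ B u₀ ∧
      ∀ᶠ u : ℝ × ℝ × ℝ in 𝓝 u₀, f ![u.1, u.2.1, u.2.2, 0] =
        A (u.1, u.2.1, u.2.2 ^ 2) + u.2.2 • B (u.1, u.2.1, u.2.2 ^ 2) := by
  obtain ⟨K, hK, hy₀, _, L, hL⟩ := exists_cauchy_representation he hf
  refine ⟨fun u => ∑ b, star (e b) * L (evenKernel K b u),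
    fun u => ∑ b, star (e b) * L (oddKernel K b u), ?_, ?_, ?_⟩
  · exact Finset.analyticAt_fun_sum _ fun b _ => analyticAt_const.mul
      ((L.analyticAt _).comp (analyticAt_parityKernels K b hu₀ hy₀).1)
  · exact Finset.analyticAt_fun_sum _ fun b _ => analyticAt_const.mul
      ((L.analyticAt _).comp (analyticAt_parityKernels K b hu₀ hy₀).2)
  · have hc : ∀ s : ℝ, Tendsto (fun u : ℝ × ℝ × ℝ => (![u.1, u.2.1, s * u.2.2, 0] : Fin 4 → ℝ))
        (𝓝 u₀) (𝓝 (planePoint u₀)) := fun s => by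
      have : Continuous fun u : ℝ × ℝ × ℝ => (![u.1, u.2.1, s * u.2.2, 0] : Fin 4 → ℝ) := by
        refine continuous_pi fun b => ?_
        fin_cases b <;> simp <;> fun_prop
      simpa [planePoint, hu₀] using this.tendsto u₀
    have hKc := hK.isClosed.isOpen_compl.mem_nhds hy₀
    filter_upwards [(hc 1).eventually hL, (hc 1).eventually hKc, (hc (-1)).eventually hKc]
      with u h1 h2 h3
    simp only [one_mul, neg_mul] at h1 h2 h3
    rw [h1, Finset.smul_sum, ← Finset.sum_add_distrib]
    refine Finset.sum_congr rfl fun b _ => ?_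
    rw [cauchyKernel_parity K b u h2 h3, map_add, map_smul, mul_add, mul_smul_comm]

/-- The operator `∂_{x₀} + i ∂_{x₁} + J ∂_β` in slice coordinates. -/
def sliceDirac (J : H) (φ : ℝ × ℝ × ℝ → H) (u : ℝ × ℝ × ℝ) : H :=
  fderiv ℝ φ u (1, 0, 0) + qi * fderiv ℝ φ u (0, 1, 0) + J * fderiv ℝ φ u (0, 0, 1)

@[simp] lemma qi_re : qi.re = 0 := rfl
@[simp] lemma qi_imI : qi.imI = 1 := rfl
@[simp] lemma qi_imJ : qi.imJ = 0 := rfl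
@[simp] lemma qi_imK : qi.imK = 0 := rfl
@[simp] lemma qj_re : qj.re = 0 := rfl
@[simp] lemma qj_imI : qj.imI = 0 := rfl
@[simp] lemma qj_imJ : qj.imJ = 1 := rfl
@[simp] lemma qj_imK : qj.imK = 0 := rfl
@[simp] lemma qk_re : qk.re = 0 := rfl
@[simp] lemma qk_imI : qk.imI = 0 := rfl
@[simp] lemma qk_imJ : qk.imJ = 0 := rfl
@[simp] lemma qk_imK : qk.imK = 1 := rfl

/-- The frame `1, i, J, iJ`. -/
def sliceFrame (J : H) : Fin 4 → H := ![1, qi, J, qi * J]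

lemma isIsometricFrame_sliceFrame {J : H} (hJ : J ∈ S1) : IsIsometricFrame (sliceFrame J) := by
  obtain ⟨h1, h2, h3⟩ := hJ
  intro x
  rw [Quaternion.star_mul_self]
  congr 1
  simp [Fin.sum_univ_four, sliceFrame, Quaternion.normSq_def', h1, h2]
  linear_combination (x 2 ^ 2 + x 3 ^ 2) * h3

/-- Forgetting the last coordinate of `ℝ⁴`. -/
def forgetLast : (Fin 4 → ℝ) →L[ℝ] ℝ × ℝ × ℝ :=
  (ContinuousLinearMap.proj 0).prod ((ContinuousLinearMap.proj 1).prod (ContinuousLinearMap.proj 2))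

lemma forgetLast_apply (x : Fin 4 → ℝ) : forgetLast x = (x 0, x 1, x 2) := rfl

lemma dirac_comp_forgetLast {J : H} {φ : ℝ × ℝ × ℝ → H} {x : Fin 4 → ℝ}
    (h : DifferentiableAt ℝ φ (forgetLast x)) :
    dirac (sliceFrame J) (fun x => φ (forgetLast x)) x = sliceDirac J φ (forgetLast x) := by
  have h1 : fderiv ℝ (fun x => φ (forgetLast x)) x = (fderiv ℝ φ (forgetLast x)).comp forgetLast :=
    (h.hasFDerivAt.comp x forgetLast.hasFDerivAt).fderiv
  have e0 : forgetLast (Pi.single 0 1) = (1, 0, 0) := by simp [forgetLast_apply]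
  have e1 : forgetLast (Pi.single 1 1) = (0, 1, 0) := by simp [forgetLast_apply]
  have e2 : forgetLast (Pi.single 2 1) = (0, 0, 1) := by simp [forgetLast_apply]
  have e3 : forgetLast (Pi.single 3 1) = 0 := by simp [forgetLast_apply]
  rw [dirac, h1]
  simp [ContinuousLinearMap.comp_apply, Fin.sum_univ_four,
    sliceFrame, sliceDirac, e0, e1, e2, e3]

lemma eventually_dirac_comp_forgetLast {J : H} {φ : ℝ × ℝ × ℝ → H} {x : Fin 4 → ℝ}
    (h : ∀ᶠ u in 𝓝 (forgetLast x), DifferentiableAt ℝ φ u ∧ sliceDirac J φ u = 0) :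
    ∀ᶠ x in 𝓝 x, DifferentiableAt ℝ (fun x => φ (forgetLast x)) x ∧
      dirac (sliceFrame J) (fun x => φ (forgetLast x)) x = 0 := by
  filter_upwards [forgetLast.continuous.continuousAt.eventually h] with z hz
  exact ⟨hz.1.comp z forgetLast.differentiableAt, (dirac_comp_forgetLast hz.1).trans hz.2⟩

lemma analyticAt_of_sliceDirac_eq_zero {J : H} (hJ : J ∈ S1) {φ : ℝ × ℝ × ℝ → H}
    {u₀ : ℝ × ℝ × ℝ}
    (h : ∀ᶠ u in 𝓝 u₀, DifferentiableAt ℝ φ u ∧ sliceDirac J φ u = 0) :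
    AnalyticAt ℝ φ u₀ := by
  let ι : ℝ × ℝ × ℝ → Fin 4 → ℝ := fun u => ![u.1, u.2.1, u.2.2, 0]
  have hι : AnalyticAt ℝ ι u₀ := by
    refine analyticAt_pi_iff.2 fun b => ?_
    fin_cases b
    · exact analyticAt_fst
    · exact analyticAt_fst.comp analyticAt_snd
    · exact analyticAt_snd.comp analyticAt_snd
    · exact analyticAt_const
  have h1 := analyticAt_of_dirac_eq_zero (isIsometricFrame_sliceFrame hJ)
    (eventually_dirac_comp_forgetLast (x := ι u₀) h)
  exact h1.comp hι

lemma exists_analyticAt_parity_slice {J : H} (hJ : J ∈ S1) {φ : ℝ × ℝ × ℝ → H}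
    {u₀ : ℝ × ℝ × ℝ} (hu₀ : u₀.2.2 = 0)
    (h : ∀ᶠ u in 𝓝 u₀, DifferentiableAt ℝ φ u ∧ sliceDirac J φ u = 0) :
    ∃ A B : ℝ × ℝ × ℝ → H, AnalyticAt ℝ A u₀ ∧ AnalyticAt ℝ B u₀ ∧
      ∀ᶠ u : ℝ × ℝ × ℝ in 𝓝 u₀, φ u =
        A (u.1, u.2.1, u.2.2 ^ 2) + u.2.2 • B (u.1, u.2.1, u.2.2 ^ 2) := by
  have hu : forgetLast (planePoint u₀) = u₀ := by
    ext <;> simp [forgetLast_apply, planePoint, hu₀]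
  exact exists_analyticAt_parity (isIsometricFrame_sliceFrame hJ) hu₀
    (f := fun x => φ (forgetLast x)) (eventually_dirac_comp_forgetLast (by rwa [hu]))

lemma S1.mul_self {J : H} (hJ : J ∈ S1) : J * J = -1 := by
  obtain ⟨h1, h2, h3⟩ := hJ
  ext
  · simp [h1, h2]
    linear_combination -h3
  · simp [h1, h2]
    ring
  · simp [h1, h2]
  · simp [h1, h2]

/-- A monogenic function vanishing on the mirror has vanishing differential there. -/
lemma hasFDerivAt_zero_of_mirror {J : H} (hJ : J ∈ S1) {W : Set (ℝ × ℝ × ℝ)} (hW : IsOpen W)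
    {h : ℝ × ℝ × ℝ → H} (hd : ∀ u ∈ W, DifferentiableAt ℝ h u ∧ sliceDirac J h u = 0)
    (h0 : ∀ u ∈ W, u.2.2 = 0 → h u = 0) {u : ℝ × ℝ × ℝ} (hu : u ∈ W) (hu0 : u.2.2 = 0) :
    HasFDerivAt h (0 : ℝ × ℝ × ℝ →L[ℝ] H) u := by
  have hdir : ∀ v : ℝ × ℝ × ℝ, v.2.2 = 0 → fderiv ℝ h u v = 0 := fun v hv => by
    have hc : ContinuousAt (fun t : ℝ => u + t • v) 0 := by fun_prop
    have h1 : HasLineDerivAt ℝ h (fderiv ℝ h u v) u v := (hd u hu).1.hasFDerivAt.hasLineDerivAt v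
    have h2 : (fun t : ℝ => h (u + t • v)) =ᶠ[𝓝 0] fun _ => 0 := by
      filter_upwards [hc.eventually (hW.mem_nhds (by simpa using hu))] with t ht
      exact h0 _ ht (by simp [hu0, hv])
    exact h1.unique ((hasDerivAt_const (0 : ℝ) (0 : H)).congr_of_eventuallyEq h2)
  have hβ : fderiv ℝ h u (0, 0, 1) = 0 := by
    have h1 := (hd u hu).2
    rw [sliceDirac, hdir _ rfl, hdir _ rfl, mul_zero, add_zero, zero_add] at h1
    have h2 := congrArg (J * ·) h1
    simpa [← mul_assoc, S1.mul_self hJ] using h2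
  have hz : fderiv ℝ h u = 0 := by
    refine ContinuousLinearMap.ext fun v => ?_
    have : v = (v.1, v.2.1, 0) + v.2.2 • ((0, 0, 1) : ℝ × ℝ × ℝ) := by ext <;> simp
    rw [this, map_add, map_smul, hβ, hdir _ rfl]
    simp
  exact hz ▸ (hd u hu).1.hasFDerivAt

open Classical in
/-- Identity principle: a monogenic function on a connected domain meeting the mirror vanishes if it
vanishes on the mirror. The proof extends the restriction to a half-space by zero. -/
lemma eq_zero_of_eq_zero_on_mirror {J : H} (hJ : J ∈ S1) {W : Set (ℝ × ℝ × ℝ)} (hW : IsOpen W)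
    (hWc : IsPreconnected W) (hW0 : ∃ u ∈ W, u.2.2 = 0) {h : ℝ × ℝ × ℝ → H}
    (hd : ∀ u ∈ W, DifferentiableAt ℝ h u ∧ sliceDirac J h u = 0)
    (h0 : ∀ u ∈ W, u.2.2 = 0 → h u = 0) : ∀ u ∈ W, h u = 0 := by
  set g : ℝ × ℝ × ℝ → H := fun u => if 0 < u.2.2 then h u else 0 with hg
  have hpos : IsOpen {u : ℝ × ℝ × ℝ | 0 < u.2.2} :=
    isOpen_lt continuous_const (by fun_prop)
  have hneg : IsOpen {u : ℝ × ℝ × ℝ | u.2.2 < 0} :=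
    isOpen_lt (by fun_prop) continuous_const
  have hgpos : ∀ u : ℝ × ℝ × ℝ, 0 < u.2.2 → g =ᶠ[𝓝 u] h := fun u hu => by
    filter_upwards [hpos.mem_nhds hu] with v hv
    exact if_pos hv
  have hgneg : ∀ u : ℝ × ℝ × ℝ, u.2.2 < 0 → g =ᶠ[𝓝 u] fun _ => 0 := fun u hu => by
    filter_upwards [hneg.mem_nhds hu] with v hv
    exact if_neg (not_lt.2 (le_of_lt hv))
  have hgd : ∀ u ∈ W, DifferentiableAt ℝ g u ∧ sliceDirac J g u = 0 := fun u hu => by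
    rcases lt_trichotomy u.2.2 0 with hlt | heq | hgt
    · exact ⟨(differentiableAt_const _).congr_of_eventuallyEq (hgneg u hlt), by
        simp [sliceDirac, (hgneg u hlt).fderiv_eq]⟩
    · have h1 := hasFDerivAt_zero_of_mirror hJ hW hd h0 hu heq
      have h2 : HasFDerivAt g (0 : ℝ × ℝ × ℝ →L[ℝ] H) u := by
        rw [hasFDerivAt_iff_isLittleO] at h1 ⊢
        refine (Asymptotics.IsBigO.of_bound 1 (Eventually.of_forall fun v => ?_)).trans_isLittleO h1
        by_cases hv : 0 < v.2.2
        · simp [hg, hv, heq, h0 u hu heq]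
        · simp [hg, hv, heq]
      exact ⟨h2.differentiableAt, by simp [sliceDirac, h2.fderiv]⟩
    · exact ⟨(hd u hu).1.congr_of_eventuallyEq (hgpos u hgt), by
        simp only [sliceDirac, (hgpos u hgt).fderiv_eq]
        exact (hd u hu).2⟩
  have han : ∀ φ : ℝ × ℝ × ℝ → H,
      (∀ u ∈ W, DifferentiableAt ℝ φ u ∧ sliceDirac J φ u = 0) → AnalyticOnNhd ℝ φ W :=
    fun φ hφ u hu => analyticAt_of_sliceDirac_eq_zero hJ
      (eventually_of_mem (hW.mem_nhds hu) hφ)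
  obtain ⟨u₀, hu₀, hu₀0⟩ := hW0
  have hnear : ∀ s : ℝ, ∃ t : ℝ, 0 < t ∧ u₀ + (0, 0, s * t) ∈ W := fun s => by
    have hc : ContinuousAt (fun t : ℝ => u₀ + ((0, 0, s * t) : ℝ × ℝ × ℝ)) 0 := by fun_prop
    have h1 := hc.eventually (hW.mem_nhds (by
      change u₀ + ((0, 0, s * 0) : ℝ × ℝ × ℝ) ∈ W
      have : ((0, 0, s * 0) : ℝ × ℝ × ℝ) = 0 := by simp
      rwa [this, add_zero]))
    obtain ⟨t, ht, ht'⟩ := ((h1.filter_mono nhdsWithin_le_nhds).and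
      (self_mem_nhdsWithin (s := Ioi (0 : ℝ)))).exists
    exact ⟨t, ht', ht⟩
  have hg0 : EqOn g 0 W := by
    obtain ⟨t, ht, htW⟩ := hnear (-1)
    exact (han g hgd).eqOn_of_preconnected_of_eventuallyEq
      (fun _ _ => analyticAt_const) hWc htW (hgneg _ (by simp [hu₀0, ht]))
  obtain ⟨t, ht, htW⟩ := hnear 1
  refine (han h hd).eqOn_of_preconnected_of_eventuallyEq
      (fun _ _ => analyticAt_const) hWc htW ?_
  filter_upwards [hW.mem_nhds htW, hgpos _ (by simpa [hu₀0] using ht)] with v hv hgv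
  rw [← hgv]
  exact hg0 hv

lemma qi_mul_self : qi * qi = -1 := by
  ext <;> simp

lemma qj_mem_S1 : qj ∈ S1 := by simp [S1]

lemma qk_mem_S1 : qk ∈ S1 := by simp [S1]

lemma S1.neg {J : H} (hJ : J ∈ S1) : -J ∈ S1 := by
  simpa [S1] using hJ

lemma S1.qi_mul {J : H} (hJ : J ∈ S1) : qi * J = -(J * qi) := by
  obtain ⟨h1, h2, -⟩ := hJ
  ext <;> simp [h1, h2]

/-- The reflection `(x₀, x₁, β) ↦ (x₀, x₁, -β)`. -/
def mirror : ℝ × ℝ × ℝ →L[ℝ] ℝ × ℝ × ℝ :=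
  (ContinuousLinearMap.fst ℝ ℝ (ℝ × ℝ)).prod
    (((ContinuousLinearMap.fst ℝ ℝ ℝ).comp (ContinuousLinearMap.snd ℝ ℝ (ℝ × ℝ))).prod
      (-(ContinuousLinearMap.snd ℝ ℝ ℝ).comp (ContinuousLinearMap.snd ℝ ℝ (ℝ × ℝ))))

lemma mirror_apply (u : ℝ × ℝ × ℝ) : mirror u = (u.1, u.2.1, -u.2.2) := rfl

lemma mirror_mirror (u : ℝ × ℝ × ℝ) : mirror (mirror u) = u := by simp [mirror_apply]

lemma psi_neg (J : H) (u : ℝ × ℝ × ℝ) : psi (-J) u = psi J (mirror u) := by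
  simp [psi, mirror_apply]

lemma continuous_psi (J : H) : Continuous (psi J) := by
  unfold psi
  have : Continuous fun u : ℝ × ℝ × ℝ => ((u.1 : ℝ) : H) :=
    Quaternion.continuous_coe.comp continuous_fst
  fun_prop

@[simp] lemma embedC_re (z : ℂ) : (embedC z).re = z.re := rfl
@[simp] lemma embedC_imI (z : ℂ) : (embedC z).imI = z.im := rfl
@[simp] lemma embedC_imJ (z : ℂ) : (embedC z).imJ = 0 := rfl
@[simp] lemma embedC_imK (z : ℂ) : (embedC z).imK = 0 := rfl

lemma embedC_add_smul (z : ℂ) (β : ℝ) (J : H) : embedC z + β • J = psi J (z.re, z.im, β) := by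
  ext <;> simp [psi]

lemma psi_mem_of_symmetric {Ω : Set H} (hsym : IsSymmetric13 Ω) {J K : H} (hJ : J ∈ S1)
    (hK : K ∈ S1) {u : ℝ × ℝ × ℝ} (h : psi J u ∈ Ω) : psi K u ∈ Ω := by
  have := hsym (embedC ⟨u.1, u.2.1⟩) ⟨rfl, rfl⟩ u.2.2 J hJ
  simp only [embedC_add_smul] at this
  exact this h K hK

lemma psi_mirror_mem {Ω : Set H} (hsym : IsSymmetric13 Ω) {u : ℝ × ℝ × ℝ} (h : psi qj u ∈ Ω) :
    psi qj (mirror u) ∈ Ω := by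
  rw [← psi_neg]
  exact psi_mem_of_symmetric hsym qj_mem_S1 (S1.neg qj_mem_S1) h

lemma isPreconnected_preimage_psi {Ω : Set H} (hΩ : IsSliceDomain13 Ω) :
    IsPreconnected (psi qj ⁻¹' Ω) := by
  have hl : ∀ u, ((psi qj u).re, (psi qj u).imI, (psi qj u).imJ) = u := fun u => by simp [psi]
  have h := (hΩ.2.2.2 qj qj_mem_S1).isPreconnected.image
    (fun x : H => (x.re, x.imI, x.imJ))
    (Quaternion.continuous_re.prodMk
      (Quaternion.continuous_imI.prodMk Quaternion.continuous_imJ)).continuousOn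
  convert h using 1
  ext u
  constructor
  · exact fun hu => ⟨psi qj u, ⟨hu, u, rfl⟩, hl u⟩
  · rintro ⟨_, ⟨hx, v, rfl⟩, rfl⟩
    simpa only [hl, mem_preimage] using hx

/-- The half-sum of `f` over the points `z ± βj`. -/
def evenPart (f : H → H) (u : ℝ × ℝ × ℝ) : H :=
  (1 / 2 : ℝ) • (f (psi qj u) + f (psi qj (mirror u)))

/-- `-j` times the half-difference of `f` over the points `z ± βj`. -/
def oddPart (f : H → H) (u : ℝ × ℝ × ℝ) : H :=
  -(qj * ((1 / 2 : ℝ) • (f (psi qj u) - f (psi qj (mirror u)))))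

/-- The first order system satisfied by stem functions, in real coordinates. -/
def StemSystem (A₀ A₁ : ℝ × ℝ × ℝ → H) (u : ℝ × ℝ × ℝ) : Prop :=
  fderiv ℝ A₀ u (1, 0, 0) + qi * fderiv ℝ A₀ u (0, 1, 0) - fderiv ℝ A₁ u (0, 0, 1) = 0 ∧
    fderiv ℝ A₀ u (0, 0, 1) + (fderiv ℝ A₁ u (1, 0, 0) - qi * fderiv ℝ A₁ u (0, 1, 0)) = 0

lemma stemSystem_parts {Ω : Set H} (hsym : IsSymmetric13 Ω) {f : H → H} (hf : Regular13 f Ω)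
    {u : ℝ × ℝ × ℝ} (hu : psi qj u ∈ Ω) :
    DifferentiableAt ℝ (evenPart f) u ∧ DifferentiableAt ℝ (oddPart f) u ∧
      StemSystem (evenPart f) (oddPart f) u := by
  obtain ⟨hd, he⟩ := hf qj qj_mem_S1 u hu
  obtain ⟨hd', he'⟩ := hf qj qj_mem_S1 _ (psi_mirror_mem hsym hu)
  set φ : ℝ × ℝ × ℝ → H := fun v => f (psi qj v)
  have h1 : HasFDerivAt (fun v => φ (mirror v)) ((fderiv ℝ φ (mirror u)).comp mirror) u :=
    hd'.hasFDerivAt.comp u mirror.hasFDerivAt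
  have h0 : HasFDerivAt (evenPart f) _ u := (hd.hasFDerivAt.add h1).const_smul (1 / 2 : ℝ)
  have h2 : HasFDerivAt (oddPart f) _ u :=
    (((hd.hasFDerivAt.sub h1).const_smul (1 / 2 : ℝ)).const_mul qj).neg
  refine ⟨h0.differentiableAt, h2.differentiableAt, ?_⟩
  have m0 : mirror (1, 0, 0) = (1, 0, 0) := by simp [mirror_apply]
  have m1 : mirror (0, 1, 0) = (0, 1, 0) := by simp [mirror_apply]
  have m2 : mirror (0, 0, 1) = -(0, 0, 1) := by simp [mirror_apply]
  rw [StemSystem, h0.fderiv, h2.fderiv]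
  simp only [smul_apply, add_apply, sub_apply, neg_apply, ContinuousLinearMap.comp_apply,
    m0, m1, m2, map_neg, smul_eq_mul]
  generalize fderiv ℝ φ u (1, 0, 0) = p₀ at *
  generalize fderiv ℝ φ u (0, 1, 0) = p₁ at *
  generalize fderiv ℝ φ u (0, 0, 1) = p₂ at *
  generalize fderiv ℝ φ (mirror u) (1, 0, 0) = q₀ at *
  generalize fderiv ℝ φ (mirror u) (0, 1, 0) = q₁ at *
  generalize fderiv ℝ φ (mirror u) (0, 0, 1) = q₂ at *
  constructor
  · have h3 : (1 / 2 : ℝ) • ((p₀ + qi * p₁ + qj * p₂) + (q₀ + qi * q₁ + qj * q₂)) = 0 := by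
      rw [he, he', add_zero, smul_zero]
    rw [← h3]
    simp only [mul_add, mul_sub, mul_neg, mul_smul_comm]
    module
  · have h3 : qj * ((1 / 2 : ℝ) • ((p₀ + qi * p₁ + qj * p₂) - (q₀ + qi * q₁ + qj * q₂))) = 0 := by
      rw [he, he', sub_zero, smul_zero, mul_zero]
    have h4 : qj * qi = -(qi * qj) := by rw [S1.qi_mul qj_mem_S1, neg_neg]
    rw [← neg_eq_zero, ← h3]
    simp only [mul_add, mul_sub, mul_neg, mul_smul_comm, ← mul_assoc, h4,
      S1.mul_self qj_mem_S1, neg_mul, one_mul]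
    module

lemma eq_evenPart_add_mul_oddPart {Ω : Set H} (hΩ : IsSliceDomain13 Ω) (hsym : IsSymmetric13 Ω)
    {f : H → H} (hf : Regular13 f Ω) {J : H} (hJ : J ∈ S1) {u : ℝ × ℝ × ℝ} (hu : psi qj u ∈ Ω) :
    f (psi J u) = evenPart f u + J * oddPart f u := by
  have key : ∀ u ∈ psi qj ⁻¹' Ω, f (psi J u) - (evenPart f u + J * oddPart f u) = 0 := by
    refine eq_zero_of_eq_zero_on_mirror hJ (hΩ.1.preimage (continuous_psi qj))
      (isPreconnected_preimage_psi hΩ) ?_ (fun u hu => ?_) fun u _ hu0 => ?_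
    · obtain ⟨x, hx, hx1, hx2⟩ := hΩ.2.2.1
      refine ⟨(x.re, x.imI, 0), ?_, rfl⟩
      have : psi qj (x.re, x.imI, 0) = x := by ext <;> simp [psi, hx1, hx2]
      rwa [mem_preimage, this]
    · obtain ⟨hd, he⟩ := hf J hJ u (psi_mem_of_symmetric hsym qj_mem_S1 hJ hu)
      obtain ⟨h0, h1, e1, e2⟩ := stemSystem_parts hsym hf hu
      have h2 := hd.hasFDerivAt.sub (h0.hasFDerivAt.add (h1.hasFDerivAt.const_mul J))
      refine ⟨h2.differentiableAt, ?_⟩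
      have h3 : fderiv ℝ (fun u => f (psi J u) - (evenPart f u + J * oddPart f u)) u = _ :=
        h2.fderiv
      rw [sliceDirac, h3]
      simp only [smul_apply, add_apply, sub_apply, smul_eq_mul]
      generalize fderiv ℝ (evenPart f) u (1, 0, 0) = a₀ at *
      generalize fderiv ℝ (evenPart f) u (0, 1, 0) = a₁ at *
      generalize fderiv ℝ (evenPart f) u (0, 0, 1) = a₂ at *
      generalize fderiv ℝ (oddPart f) u (1, 0, 0) = b₀ at *
      generalize fderiv ℝ (oddPart f) u (0, 1, 0) = b₁ at *
      generalize fderiv ℝ (oddPart f) u (0, 0, 1) = b₂ at *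
      have h4 : (0 : H) - (a₀ + qi * a₁ - b₂) - J * (a₂ + (b₀ - qi * b₁)) = 0 := by
        rw [e1, e2]; simp
      rw [← h4, ← he]
      simp only [mul_add, mul_sub, ← mul_assoc, S1.qi_mul hJ, S1.mul_self hJ, neg_mul, one_mul]
      abel
    · have h1 : mirror u = u := by ext <;> simp [mirror_apply, hu0]
      have h2 : psi J u = psi qj u := by simp [psi, hu0]
      simp only [evenPart, oddPart, h1, h2]
      simp [← two_smul ℝ (f (psi qj u)), smul_smul]
  exact sub_eq_zero.1 (key u hu)

lemma analyticAt_parts {Ω : Set H} (hΩ : IsOpen Ω) (hsym : IsSymmetric13 Ω) {f : H → H}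
    (hf : Regular13 f Ω) {u : ℝ × ℝ × ℝ} (hu : psi qj u ∈ Ω) :
    AnalyticAt ℝ (evenPart f) u ∧ AnalyticAt ℝ (oddPart f) u := by
  have h : ∀ v, psi qj v ∈ Ω → AnalyticAt ℝ (fun v => f (psi qj v)) v := fun v hv =>
    analyticAt_of_sliceDirac_eq_zero qj_mem_S1 (eventually_of_mem
      ((hΩ.preimage (continuous_psi qj)).mem_nhds hv) fun w hw => hf qj qj_mem_S1 w hw)
  have h1 : AnalyticAt ℝ (fun v => f (psi qj (mirror v))) u :=
    (h _ (psi_mirror_mem hsym hu)).comp (mirror.analyticAt u)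
  have h2 : AnalyticAt ℝ (fun v => (1 / 2 : ℝ) • (f (psi qj v) - f (psi qj (mirror v)))) u :=
    ((h u hu).fun_sub h1).fun_const_smul
  have h3 : AnalyticAt ℝ (fun v => qj * (1 / 2 : ℝ) • (f (psi qj v) - f (psi qj (mirror v)))) u :=
    analyticAt_const.fun_mul h2
  exact ⟨((h u hu).fun_add h1).fun_const_smul, h3.fun_neg⟩

/-- The component of `x` in the plane `jℝ + kℝ`. -/
def transversePart (x : H) : H := x.imJ • qj + x.imK • qk

/-- The coordinates `(x₀, x₁, √(x₂² + x₃²))` of `x`. -/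
def cylindrical (x : H) : ℝ × ℝ × ℝ := (x.re, x.imI, √(x.imJ ^ 2 + x.imK ^ 2))

lemma exists_mem_S1_eq_psi (x : H) :
    ∃ J ∈ S1, transversePart x = (cylindrical x).2.2 • J ∧ x = psi J (cylindrical x) := by
  have hs : 0 ≤ x.imJ ^ 2 + x.imK ^ 2 := by positivity
  have hx : ∀ J : H, transversePart x = (cylindrical x).2.2 • J → x = psi J (cylindrical x) := by
    intro J h
    rw [psi, ← h]
    ext <;> simp [transversePart, cylindrical]
  suffices h : ∃ J ∈ S1, transversePart x = (cylindrical x).2.2 • J by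
    obtain ⟨J, hJ, h⟩ := h
    exact ⟨J, hJ, h, hx J h⟩
  rcases eq_or_ne (cylindrical x).2.2 0 with h0 | h0
  · have h1 : x.imJ ^ 2 + x.imK ^ 2 = 0 := (Real.sqrt_eq_zero hs).1 h0
    have h2 : x.imJ = 0 := by nlinarith [sq_nonneg x.imJ, sq_nonneg x.imK]
    have h3 : x.imK = 0 := by nlinarith [sq_nonneg x.imJ, sq_nonneg x.imK]
    exact ⟨qj, qj_mem_S1, by simp [transversePart, h0, h2, h3]⟩
  · refine ⟨(cylindrical x).2.2⁻¹ • transversePart x, ⟨?_, ?_, ?_⟩, ?_⟩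
    · simp [transversePart]
    · simp [transversePart]
    · have h1 : (cylindrical x).2.2 ^ 2 = x.imJ ^ 2 + x.imK ^ 2 := Real.sq_sqrt hs
      simp [transversePart]
      field_simp
      exact h1.symm
    · rw [smul_smul, mul_inv_cancel₀ h0, one_smul]

lemma analyticAt_coordinates (x : H) :
    AnalyticAt ℝ (fun x : H => x.re) x ∧ AnalyticAt ℝ (fun x : H => x.imI) x ∧
      AnalyticAt ℝ (fun x : H => x.imJ) x ∧ AnalyticAt ℝ (fun x : H => x.imK) x :=
  ⟨(⟨QuaternionAlgebra.reₗ _ _ _, Quaternion.continuous_re⟩ : H →L[ℝ] ℝ).analyticAt x,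
    (⟨QuaternionAlgebra.imIₗ _ _ _, Quaternion.continuous_imI⟩ : H →L[ℝ] ℝ).analyticAt x,
    (⟨QuaternionAlgebra.imJₗ _ _ _, Quaternion.continuous_imJ⟩ : H →L[ℝ] ℝ).analyticAt x,
    (⟨QuaternionAlgebra.imKₗ _ _ _, Quaternion.continuous_imK⟩ : H →L[ℝ] ℝ).analyticAt x⟩

lemma analyticAt_of_regular {Ω : Set H} (hΩ : IsSliceDomain13 Ω) (hsym : IsSymmetric13 Ω)
    {f : H → H} (hf : Regular13 f Ω) {x : H} (hx : x ∈ Ω) : AnalyticAt ℝ f x := by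
  have hmem : ∀ y ∈ Ω, psi qj (cylindrical y) ∈ Ω := fun y hy => by
    obtain ⟨J, hJ, -, h⟩ := exists_mem_S1_eq_psi y
    exact psi_mem_of_symmetric hsym hJ qj_mem_S1 (h ▸ hy)
  obtain ⟨c0, c1, c2, c3⟩ := analyticAt_coordinates x
  have ht : AnalyticAt ℝ transversePart x :=
    (c2.smul analyticAt_const).fun_add (c3.smul analyticAt_const)
  have hs : AnalyticAt ℝ (fun x : H => x.imJ ^ 2 + x.imK ^ 2) x := (c2.pow 2).fun_add (c3.pow 2)
  by_cases h0 : x.imJ ^ 2 + x.imK ^ 2 = 0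
  · have hc0 : (cylindrical x).2.2 = 0 := by simp [cylindrical, h0]
    obtain ⟨A, B, hA, hB, hAB⟩ := exists_analyticAt_parity_slice qj_mem_S1 hc0
      (φ := fun u => f (psi qj u)) (eventually_of_mem
        ((hΩ.1.preimage (continuous_psi qj)).mem_nhds (hmem x hx)) fun u hu => hf qj qj_mem_S1 u hu)
    have hcont : Continuous cylindrical :=
      Quaternion.continuous_re.prodMk (Quaternion.continuous_imI.prodMk
        (((Quaternion.continuous_imJ.pow 2).add (Quaternion.continuous_imK.pow 2)).sqrt))
    have hm : mirror (cylindrical x) = cylindrical x := by ext <;> simp [mirror_apply, hc0]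
    have hAB' : ∀ᶠ u in 𝓝 (cylindrical x), f (psi qj (mirror u)) =
        A (u.1, u.2.1, u.2.2 ^ 2) - u.2.2 • B (u.1, u.2.1, u.2.2 ^ 2) := by
      have h1 : Tendsto mirror (𝓝 (cylindrical x)) (𝓝 (cylindrical x)) := by
        simpa only [hm] using mirror.continuous.tendsto (cylindrical x)
      filter_upwards [h1.eventually hAB] with u hu
      simpa [mirror_apply, sub_eq_add_neg] using hu
    set w : H → ℝ × ℝ × ℝ := fun y => (y.re, y.imI, y.imJ ^ 2 + y.imK ^ 2) with hw
    have hwa : AnalyticAt ℝ w x := c0.prod (c1.prod hs)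
    have hwx : w x = cylindrical x := by simp [hw, cylindrical, h0]
    have h2 : AnalyticAt ℝ (fun y => A (w y) - transversePart y * (qj * B (w y))) x :=
      (hA.comp_of_eq hwa hwx).fun_sub (ht.fun_mul (analyticAt_const.fun_mul
        (hB.comp_of_eq hwa hwx)))
    refine h2.congr ?_
    filter_upwards [hcont.continuousAt.eventually hAB, hcont.continuousAt.eventually hAB',
      hΩ.1.mem_nhds hx] with y h3 h4 hy
    obtain ⟨J, hJ, h5, h6⟩ := exists_mem_S1_eq_psi y
    have h7 : ((cylindrical y).1, (cylindrical y).2.1, (cylindrical y).2.2 ^ 2) = w y := by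
      simp [cylindrical, hw, Real.sq_sqrt (show 0 ≤ y.imJ ^ 2 + y.imK ^ 2 by positivity)]
    conv_rhs => rw [h6, eq_evenPart_add_mul_oddPart hΩ hsym hf hJ (hmem y hy)]
    rw [evenPart, oddPart, h3, h4, h7, h5]
    simp only [mul_add, mul_sub, mul_neg, mul_smul_comm, smul_mul_assoc]
    module
  · have hr : AnalyticAt ℝ (fun x : H => √(x.imJ ^ 2 + x.imK ^ 2)) x :=
      (Real.contDiffAt_sqrt h0).analyticAt.comp_of_eq hs rfl
    have hr0 : √(x.imJ ^ 2 + x.imK ^ 2) ≠ 0 := by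
      rwa [Ne, Real.sqrt_eq_zero (by positivity)]
    have hc : AnalyticAt ℝ cylindrical x := c0.prod (c1.prod hr)
    obtain ⟨hA, hB⟩ := analyticAt_parts hΩ.1 hsym hf (hmem x hx)
    have h2 : AnalyticAt ℝ (fun y => evenPart f (cylindrical y) +
        (√(y.imJ ^ 2 + y.imK ^ 2))⁻¹ • transversePart y * oddPart f (cylindrical y)) x :=
      (hA.comp hc).fun_add (((hr.inv hr0).smul ht).fun_mul (hB.comp hc))
    refine h2.congr ?_
    filter_upwards [hr.continuousAt.eventually_ne hr0, hΩ.1.mem_nhds hx] with y h3 hy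
    obtain ⟨J, hJ, h5, h6⟩ := exists_mem_S1_eq_psi y
    conv_rhs => rw [h6, eq_evenPart_add_mul_oddPart hΩ hsym hf hJ (hmem y hy)]
    rw [h5, smul_smul, show (cylindrical y).2.2 = √(y.imJ ^ 2 + y.imK ^ 2) from rfl,
      inv_mul_cancel₀ h3, one_smul]

section Harmonic

variable {F G : ℂ × ℝ → H} {p : ℂ × ℝ} {D : Set (ℂ × ℝ)}

lemma analyticAt_pdC (hF : AnalyticAt ℝ F p) (e : ℂ × ℝ) : AnalyticAt ℝ (pdC e F) p :=
  ((ContinuousLinearMap.apply ℝ H e).analyticAt _).comp hF.fderiv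

lemma pdC_pdC (hF : AnalyticAt ℝ F p) (e e' : ℂ × ℝ) :
    pdC e (pdC e' F) p = fderiv ℝ (fderiv ℝ F) p e e' := by
  have h : HasFDerivAt (pdC e' F) _ p :=
    (ContinuousLinearMap.apply ℝ H e').hasFDerivAt.comp p hF.fderiv.differentiableAt.hasFDerivAt
  rw [pdC, h.fderiv]
  rfl

open scoped ContDiff in
lemma pdC_comm (hF : AnalyticAt ℝ F p) (e e' : ℂ × ℝ) :
    pdC e (pdC e' F) p = pdC e' (pdC e F) p := by
  rw [pdC_pdC hF, pdC_pdC hF]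
  exact (hF.contDiffAt.isSymmSndFDerivAt (n := ω) (by simp)) e e'

lemma pdC_eq_zero (hD : IsOpen D) (hp : p ∈ D) (h : ∀ p ∈ D, F p = 0) (e : ℂ × ℝ) :
    pdC e F p = 0 := by
  have : F =ᶠ[𝓝 p] fun _ => 0 := eventually_of_mem (hD.mem_nhds hp) h
  simp [pdC, this.fderiv_eq]

/-- Solutions of the stem system are harmonic. -/
lemma harmonic_of_stem_system (hD : IsOpen D) (hF : AnalyticOnNhd ℝ F D)
    (hG : AnalyticOnNhd ℝ G D)
    (h1 : ∀ p ∈ D, pdC (1, 0) F p + qi * pdC (Complex.I, 0) F p - pdC (0, 1) G p = 0)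
    (h2 : ∀ p ∈ D, pdC (0, 1) F p + (pdC (1, 0) G p - qi * pdC (Complex.I, 0) G p) = 0)
    (hp : p ∈ D) :
    pdC (1, 0) (pdC (1, 0) F) p + pdC (Complex.I, 0) (pdC (Complex.I, 0) F) p
        + pdC (0, 1) (pdC (0, 1) F) p = 0 ∧
      pdC (1, 0) (pdC (1, 0) G) p + pdC (Complex.I, 0) (pdC (Complex.I, 0) G) p
        + pdC (0, 1) (pdC (0, 1) G) p = 0 := by
  have hdF : ∀ e, DifferentiableAt ℝ (pdC e F) p :=
    fun e => (analyticAt_pdC (hF p hp) e).differentiableAt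
  have hdG : ∀ e, DifferentiableAt ℝ (pdC e G) p :=
    fun e => (analyticAt_pdC (hG p hp) e).differentiableAt
  have d1 : ∀ e, pdC e (pdC (1, 0) F) p + qi * pdC e (pdC (Complex.I, 0) F) p
      - pdC e (pdC (0, 1) G) p = 0 := fun e => by
    rw [← pdC_eq_zero hD hp h1 e]
    exact (congrArg (· e) (((hdF _).hasFDerivAt.add ((hdF _).hasFDerivAt.const_mul qi)).sub
      (hdG _).hasFDerivAt).fderiv).symm
  have d2 : ∀ e, pdC e (pdC (0, 1) F) p + (pdC e (pdC (1, 0) G) p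
      - qi * pdC e (pdC (Complex.I, 0) G) p) = 0 := fun e => by
    rw [← pdC_eq_zero hD hp h2 e]
    exact (congrArg (· e) ((hdF _).hasFDerivAt.add ((hdG _).hasFDerivAt.sub
      ((hdG _).hasFDerivAt.const_mul qi))).fderiv).symm
  have a1 := d1 (1, 0)
  have a2 := d1 (Complex.I, 0)
  have a3 := d1 (0, 1)
  have b1 := d2 (1, 0)
  have b2 := d2 (Complex.I, 0)
  have b3 := d2 (0, 1)
  rw [pdC_comm (hF p hp) (Complex.I, 0) (1, 0)] at a2
  rw [pdC_comm (hG p hp) (0, 1) (1, 0), pdC_comm (hG p hp) (0, 1) (Complex.I, 0)] at b3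
  rw [pdC_comm (hF p hp) (0, 1) (1, 0), pdC_comm (hF p hp) (0, 1) (Complex.I, 0)] at a3
  rw [pdC_comm (hG p hp) (Complex.I, 0) (1, 0)] at b2
  have comb : ∀ {a b c : H}, a = 0 → b = 0 → c = 0 → a - qi * b + c = 0 := by
    rintro _ _ _ rfl rfl rfl
    simp
  have comb' : ∀ {a b c : H}, a = 0 → b = 0 → c = 0 → a + qi * b - c = 0 := by
    rintro _ _ _ rfl rfl rfl
    simp
  constructor
  · rw [← comb a1 a2 b3]
    simp only [mul_add, mul_sub, ← mul_assoc, qi_mul_self, neg_mul, one_mul]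
    abel
  · rw [← comb' b1 b2 a3]
    simp only [mul_add, mul_sub, ← mul_assoc, qi_mul_self, neg_mul, one_mul]
    abel

end Harmonic

lemma eq_and_eq_of_forall_S1 {a b c d : H} (h : ∀ J ∈ S1, a + J * b = c + J * d) :
    a = c ∧ b = d := by
  have h1 := h qj qj_mem_S1
  have h2 := h (-qj) (S1.neg qj_mem_S1)
  have h3 : (2 : ℝ) • a = (2 : ℝ) • c := by
    calc (2 : ℝ) • a = (a + qj * b) + (a + -qj * b) := by rw [neg_mul]; module
      _ = (2 : ℝ) • c := by rw [h1, h2, neg_mul]; module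
  have h4 : a = c := smul_right_injective H (two_ne_zero' ℝ) h3
  refine ⟨h4, ?_⟩
  rw [h4, add_right_inj] at h1
  have h5 := congrArg (qj * ·) h1
  simpa [← mul_assoc, S1.mul_self qj_mem_S1] using h5

lemma mem_hplane_iff {J x : H} (hJ : J ∈ S1) :
    x ∈ hplane J ↔ x.imJ * J.imK = x.imK * J.imJ := by
  obtain ⟨h1, h2, h3⟩ := hJ
  constructor
  · rintro ⟨u, rfl⟩
    simp [psi]
    ring
  · intro h
    refine ⟨(x.re, x.imI, x.imJ * J.imJ + x.imK * J.imK), ?_⟩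
    ext
    · simp [psi, h1]
    · simp [psi, h2]
    · simp [psi]
      linear_combination x.imJ * h3 - J.imK * h
    · simp [psi]
      linear_combination x.imK * h3 + J.imJ * h

lemma forall_add_mul_mem_hplane_iff (a b : H) :
    (∀ J ∈ S1, a + J * b ∈ hplane J) ↔ a ∈ Cset ∧ b.imI = 0 := by
  constructor
  · intro h
    have h1 := (mem_hplane_iff qj_mem_S1).1 (h qj qj_mem_S1)
    have h2 := (mem_hplane_iff (S1.neg qj_mem_S1)).1 (h _ (S1.neg qj_mem_S1))
    have h3 := (mem_hplane_iff qk_mem_S1).1 (h qk qk_mem_S1)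
    have h4 := (mem_hplane_iff (S1.neg qk_mem_S1)).1 (h _ (S1.neg qk_mem_S1))
    simp at h1 h2 h3 h4
    exact ⟨⟨by linarith, by linarith⟩, by linarith⟩
  · rintro ⟨⟨h1, h2⟩, h3⟩ J hJ
    rw [mem_hplane_iff hJ]
    simp [h1, h2, h3, hJ.1, hJ.2.1]
    ring

/-- on a `(1,3)`-symmetric `(1,3)`-slice domain `Ω` with
`D = {(z,β) : z+βJ ∈ Ω for all J ∈ S¹}`, every `(1,3)`-regular `f : Ω → ℍ` is induced
by a unique stem function `(F_∅,F₁)` (`F_∅` even and `F₁` odd in `β`):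
`f(z+βJ) = F_∅(z,β) + J·F₁(z,β)`. Moreover `D` is open, `F_∅, F₁` are real analytic on
`D` and `f` is real analytic on `Ω`; the Cauchy–Riemann-type system
`(∂_{x₀}+i∂_{x₁})F_∅ − ∂_βF₁ = 0`, `∂_βF_∅ + (∂_{x₀}−i∂_{x₁})F₁ = 0` holds on `D`,
whence `F_∅, F₁` are harmonic in `(x₀,x₁,β)`; finally `f` preserves every slice
`ℝ³_J` iff `F_∅` is `ℂ`-valued and `F₁` is `(ℝ+jℝ+kℝ)`-valued. -/
theorem stmt19 (Ω : Set H) (hΩ : IsSliceDomain13 Ω) (hsym : IsSymmetric13 Ω)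
    (D : Set (ℂ × ℝ)) (hD : D = {p : ℂ × ℝ | ∀ J ∈ S1, embedC p.1 + p.2 • J ∈ Ω})
    (f : H → H) (hf : Regular13 f Ω) :
    IsOpen D ∧
    AnalyticOnNhd ℝ f Ω ∧
    ∃ F0 F1 : ℂ × ℝ → H,
      (∀ p ∈ D, F0 (p.1, -p.2) = F0 p) ∧
      (∀ p ∈ D, F1 (p.1, -p.2) = -F1 p) ∧
      (∀ p ∈ D, ∀ J ∈ S1, f (embedC p.1 + p.2 • J) = F0 p + J * F1 p) ∧
      (∀ G0 G1 : ℂ × ℝ → H,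
        (∀ p ∈ D, G0 (p.1, -p.2) = G0 p) →
        (∀ p ∈ D, G1 (p.1, -p.2) = -G1 p) →
        (∀ p ∈ D, ∀ J ∈ S1, f (embedC p.1 + p.2 • J) = G0 p + J * G1 p) →
        ∀ p ∈ D, G0 p = F0 p ∧ G1 p = F1 p) ∧
      AnalyticOnNhd ℝ F0 D ∧ AnalyticOnNhd ℝ F1 D ∧
      (∀ p ∈ D,
        pdC (1, 0) F0 p + qi * pdC (Complex.I, 0) F0 p - pdC (0, 1) F1 p = 0) ∧
      (∀ p ∈ D,
        pdC (0, 1) F0 p + (pdC (1, 0) F1 p - qi * pdC (Complex.I, 0) F1 p) = 0) ∧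
      (∀ p ∈ D,
        pdC (1, 0) (pdC (1, 0) F0) p + pdC (Complex.I, 0) (pdC (Complex.I, 0) F0) p
          + pdC (0, 1) (pdC (0, 1) F0) p = 0) ∧
      (∀ p ∈ D,
        pdC (1, 0) (pdC (1, 0) F1) p + pdC (Complex.I, 0) (pdC (Complex.I, 0) F1) p
          + pdC (0, 1) (pdC (0, 1) F1) p = 0) ∧
      ((∀ J ∈ S1, ∀ x ∈ Ω ∩ hplane J, f x ∈ hplane J) ↔
        ((∀ p ∈ D, F0 p ∈ Cset) ∧ (∀ p ∈ D, (F1 p).imI = 0))) := by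
  subst hD
  let c : ℂ × ℝ →L[ℝ] ℝ × ℝ × ℝ :=
    (Complex.reCLM.comp (ContinuousLinearMap.fst ℝ ℂ ℝ)).prod
      ((Complex.imCLM.comp (ContinuousLinearMap.fst ℝ ℂ ℝ)).prod (ContinuousLinearMap.snd ℝ ℂ ℝ))
  have hc : ∀ p : ℂ × ℝ, c p = (p.1.re, p.1.im, p.2) := fun p => rfl
  have hpsi : ∀ (p : ℂ × ℝ) (J : H), embedC p.1 + p.2 • J = psi J (c p) :=
    fun p J => embedC_add_smul p.1 p.2 J
  simp only [hpsi]
  have hmem : ∀ p : ℂ × ℝ, (∀ J ∈ S1, psi J (c p) ∈ Ω) ↔ psi qj (c p) ∈ Ω := fun p =>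
    ⟨fun h => h qj qj_mem_S1, fun h J hJ => psi_mem_of_symmetric hsym qj_mem_S1 hJ h⟩
  simp only [hmem]
  set D : Set (ℂ × ℝ) := {p | psi qj (c p) ∈ Ω}
  have hDo : IsOpen D := hΩ.1.preimage ((continuous_psi qj).comp c.continuous)
  have hmc : ∀ p : ℂ × ℝ, c (p.1, -p.2) = mirror (c p) := fun p => rfl
  have hana : ∀ p ∈ D, AnalyticAt ℝ (evenPart f) (c p) ∧ AnalyticAt ℝ (oddPart f) (c p) :=
    fun p hp => analyticAt_parts hΩ.1 hsym hf hp
  have hF0 : AnalyticOnNhd ℝ (fun p => evenPart f (c p)) D :=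
    fun p hp => (hana p hp).1.comp (c.analyticAt p)
  have hF1 : AnalyticOnNhd ℝ (fun p => oddPart f (c p)) D :=
    fun p hp => (hana p hp).2.comp (c.analyticAt p)
  have hpd : ∀ (A : ℝ × ℝ × ℝ → H) (p e : ℂ × ℝ), DifferentiableAt ℝ A (c p) →
      pdC e (fun p => A (c p)) p = fderiv ℝ A (c p) (c e) := fun A p e hA => by
    have h : HasFDerivAt (fun p => A (c p)) ((fderiv ℝ A (c p)).comp c) p :=
      hA.hasFDerivAt.comp p c.hasFDerivAt
    rw [pdC, h.fderiv, ContinuousLinearMap.comp_apply]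
  have c0 : c (1, 0) = (1, 0, 0) := by simp [hc]
  have c1 : c (Complex.I, 0) = (0, 1, 0) := by simp [hc]
  have c2 : c (0, 1) = (0, 0, 1) := by simp [hc]
  have hrep : ∀ p ∈ D, ∀ J ∈ S1, f (psi J (c p)) = evenPart f (c p) + J * oddPart f (c p) :=
    fun p hp J hJ => eq_evenPart_add_mul_oddPart hΩ hsym hf hJ hp
  have hs1 : ∀ p ∈ D, pdC (1, 0) (fun p => evenPart f (c p)) p
      + qi * pdC (Complex.I, 0) (fun p => evenPart f (c p)) p
      - pdC (0, 1) (fun p => oddPart f (c p)) p = 0 := fun p hp => by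
    obtain ⟨h0, h1, e1, -⟩ := stemSystem_parts hsym hf hp
    rwa [hpd _ _ _ h0, hpd _ _ _ h0, hpd _ _ _ h1, c0, c1, c2]
  have hs2 : ∀ p ∈ D, pdC (0, 1) (fun p => evenPart f (c p)) p
      + (pdC (1, 0) (fun p => oddPart f (c p)) p
        - qi * pdC (Complex.I, 0) (fun p => oddPart f (c p)) p) = 0 := fun p hp => by
    obtain ⟨h0, h1, -, e2⟩ := stemSystem_parts hsym hf hp
    rwa [hpd _ _ _ h0, hpd _ _ _ h1, hpd _ _ _ h1, c0, c1, c2]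
  refine ⟨hDo, fun x hx => analyticAt_of_regular hΩ hsym hf hx,
    fun p => evenPart f (c p), fun p => oddPart f (c p), fun p _ => ?_, fun p _ => ?_, hrep,
    fun G0 G1 _ _ hG p hp => ?_, hF0, hF1, hs1, hs2,
    fun p hp => (harmonic_of_stem_system hDo hF0 hF1 hs1 hs2 hp).1,
    fun p hp => (harmonic_of_stem_system hDo hF0 hF1 hs1 hs2 hp).2, fun h => ?_, ?_⟩
  · simp only [hmc, evenPart, mirror_mirror, add_comm]
  · simp only [hmc, oddPart, mirror_mirror]
    rw [← neg_sub (f (psi qj (c p))), smul_neg, mul_neg]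
  · exact eq_and_eq_of_forall_S1 fun J hJ => (hG p hp J hJ).symm.trans (hrep p hp J hJ)
  · have hv : ∀ p ∈ D, ∀ J ∈ S1, evenPart f (c p) + J * oddPart f (c p) ∈ hplane J :=
      fun p hp J hJ => by
        rw [← hrep p hp J hJ]
        exact h J hJ _ ⟨psi_mem_of_symmetric hsym qj_mem_S1 hJ hp, _, rfl⟩
    exact ⟨fun p hp => ((forall_add_mul_mem_hplane_iff _ _).1 (hv p hp)).1,
      fun p hp => ((forall_add_mul_mem_hplane_iff _ _).1 (hv p hp)).2⟩
  · rintro ⟨h0, h1⟩ J hJ _ ⟨hx, u, rfl⟩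
    have hp : (⟨⟨u.1, u.2.1⟩, u.2.2⟩ : ℂ × ℝ) ∈ D :=
      psi_mem_of_symmetric hsym hJ qj_mem_S1 hx
    have h2 := (forall_add_mul_mem_hplane_iff _ _).2 ⟨h0 _ hp, h1 _ hp⟩ J hJ
    rwa [← hrep _ hp J hJ] at h2
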